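/- arXiv:2104.12718 — 4 statements merged into one kernel-verified Lean document; each statement's English description precedes it below -/
import Mathlib

section
/- There exist constants a > 0 and n₀ such that the following holds for all n ≥ n₀. Let L be a uniformly random n×n Latin square with symbols [n], and let X(L) = max over s ∈ [n] of |{i ∈ [n] : L(i,i) = s}| be the maximum number of times any symbol appears on the leading diagonal of L. Then for every t with t ≥ 3 log n / log log n, the probability that X(L) ≥ t is at most exp(−a·t·log t). -/
open scoped Classical

noncomputable section

namespace RandomLatin

/-- `φ` is a proper `n`-arc-colouring of the complete digraph with loops on `Fin n`:
`φ i j` is the colour of the arc `i → j`, and no two arcs of the same colour share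
a common tail or a common head. -/
def IsProper {n : ℕ} (φ : Fin n → Fin n → Fin n) : Prop :=
  (∀ i j j' : Fin n, φ i j = φ i j' → j = j') ∧
  (∀ i i' j : Fin n, φ i j = φ i' j → i = i')

/-- The set `Φ(K_n^↔)` of proper `n`-arc-colourings of the complete digraph with loops. -/
abbrev Colouring (n : ℕ) : Type := {φ : Fin n → Fin n → Fin n // IsProper φ}

/-- `L` is an `n × n` Latin square with symbols `Fin n`. -/
def IsLatin {n : ℕ} (L : Fin n → Fin n → Fin n) : Prop :=
  (∀ i, Function.Bijective (L i)) ∧ (∀ j, Function.Bijective fun i => L i j)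

abbrev LatinSquare (n : ℕ) : Type := {L : Fin n → Fin n → Fin n // IsLatin L}

/-- The set of positions `{(i, σ i) : i}` is a (full) transversal of `L`. -/
def IsTransversal {n : ℕ} (L : Fin n → Fin n → Fin n) (σ : Equiv.Perm (Fin n)) : Prop :=
  Function.Bijective fun i => L i (σ i)

/-- A transversal is Hamilton if its arc set `{i → σ i}` is a directed Hamilton cycle. -/
def IsHamiltonTransversal {n : ℕ} (L : Fin n → Fin n → Fin n) (σ : Equiv.Perm (Fin n)) :
    Prop :=
  IsTransversal L σ ∧ σ.IsCycle ∧ σ.support = Finset.univ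

def hamTransversalCount {n : ℕ} (L : Fin n → Fin n → Fin n) : ℕ :=
  Nat.card {σ : Equiv.Perm (Fin n) // IsHamiltonTransversal L σ}

/-- The number of rainbow directed Hamilton cycles of a coloured `K_n^↔`. -/
def rainbowHamCycleCount {n : ℕ} (φ : Fin n → Fin n → Fin n) : ℕ :=
  Nat.card {σ : Equiv.Perm (Fin n) //
    Function.Injective (fun i => φ i (σ i)) ∧ σ.IsCycle ∧ σ.support = Finset.univ}

/-- The maximum number of appearances of a symbol on the leading diagonal. -/
def diagMax {n : ℕ} (L : Fin n → Fin n → Fin n) : ℕ :=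
  Finset.univ.sup fun s : Fin n => (Finset.univ.filter fun i : Fin n => L i i = s).card

/-! ### The spaces `𝒢_D` -/

/-- `𝒢_D`: proper arc-colourings, with colour set `D`, of spanning subdigraphs of `K_n^↔`
in which every vertex has in- and out-degree `|D|`.  `f d i` is the head of the unique
`d`-coloured arc with tail `i`. -/
def GD (n : ℕ) (D : Finset (Fin n)) : Type :=
  {f : {d : Fin n // d ∈ D} → Fin n → Fin n //
    (∀ d, Function.Bijective (f d)) ∧ ∀ i : Fin n, Function.Injective fun d => f d i}

/-- `comp H`: the number of completions of `H ∈ 𝒢_D` to an element of `Φ(K_n^↔)`,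
i.e. the number of `g ∈ 𝒢_{Dᶜ}` whose arc set is disjoint from that of `H`. -/
def completionCount {n : ℕ} {D : Finset (Fin n)} (H : GD n D) : ℕ :=
  Nat.card {g : GD n Dᶜ //
    ∀ (d : {d : Fin n // d ∈ D}) (d' : {d : Fin n // d ∈ Dᶜ}) (i : Fin n),
      H.1 d i ≠ g.1 d' i}

/-- `e_H(A₁, A₂)`: the number of arcs of `H` with tail in `A₁` and head in `A₂`. -/
def eArcs {n : ℕ} {D : Finset (Fin n)} (H : GD n D) (A₁ A₂ : Finset (Fin n)) : ℕ :=
  Nat.card {p : {d : Fin n // d ∈ D} × Fin n // p.2 ∈ A₁ ∧ H.1 p.1 p.2 ∈ A₂}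

/-! ### Absorbing gadgets -/

/-- A `(v,c)`-absorbing gadget, recorded by its vertices `x 0 = x₁, …, x 5 = x₆`. -/
def IsAbsGadget {n : ℕ} (φ : Fin n → Fin n → Fin n) (v c : Fin n) (x : Fin 6 → Fin n) :
    Prop :=
  ([v, x 0, x 1, x 2, x 3, x 4, x 5] : List (Fin n)).Nodup ∧
  φ (x 0) v = φ (x 3) (x 5) ∧
  φ v (x 1) = φ (x 2) (x 4) ∧
  φ (x 0) (x 1) = φ (x 2) (x 3) ∧
  φ (x 4) (x 5) = c ∧
  ([φ (x 0) v, φ v (x 1), φ (x 0) (x 1), c] : List (Fin n)).Nodup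

def absGadgetVerts {n : ℕ} (v : Fin n) (x : Fin 6 → Fin n) : Finset (Fin n) :=
  insert v (Finset.image x Finset.univ)

/-- The gadget contains an arc of colour `d`. -/
def absGadgetHasColour {n : ℕ} (φ : Fin n → Fin n → Fin n) (v : Fin n)
    (x : Fin 6 → Fin n) (d : Fin n) : Prop :=
  d = φ (x 0) v ∨ d = φ v (x 1) ∨ d = φ (x 0) (x 1) ∨ d = φ (x 2) (x 3) ∨
  d = φ (x 2) (x 4) ∨ d = φ (x 3) (x 5) ∨ d = φ (x 4) (x 5)

def WellSpreadAbsGadgets {n : ℕ} (φ : Fin n → Fin n → Fin n) (v c : Fin n)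
    (𝒜 : Finset (Fin 6 → Fin n)) : Prop :=
  (∀ u : Fin n, u ≠ v → (𝒜.filter fun x => u ∈ absGadgetVerts v x).card ≤ n) ∧
  (∀ d : Fin n, d ≠ c → (𝒜.filter fun x => absGadgetHasColour φ v x d).card ≤ n)

/-! ### Bridging gadgets (with respect to a full colouring) -/

/-- A `(y,z)`-bridging gadget, recorded by its vertices `w 0 = w₁, …, w 5 = w₆`. -/
def IsBridgeGadget {n : ℕ} (φ : Fin n → Fin n → Fin n) (y z : Fin n)
    (w : Fin 6 → Fin n) : Prop :=
  ([y, z, w 0, w 1, w 2, w 3, w 4, w 5] : List (Fin n)).Nodup ∧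
  φ y (w 0) = φ (w 5) (w 4) ∧
  φ (w 1) (w 0) = φ (w 5) z ∧
  φ (w 3) y = φ (w 1) (w 2) ∧
  φ (w 3) (w 4) = φ z (w 2) ∧
  ([φ y (w 0), φ (w 1) (w 0), φ (w 3) y, φ (w 3) (w 4)] : List (Fin n)).Nodup

def bridgeVerts {n : ℕ} (y z : Fin n) (w : Fin 6 → Fin n) : Finset (Fin n) :=
  insert y (insert z (Finset.image w Finset.univ))

def bridgeHasColour {n : ℕ} (φ : Fin n → Fin n → Fin n) (y z : Fin n)
    (w : Fin 6 → Fin n) (d : Fin n) : Prop :=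
  d = φ y (w 0) ∨ d = φ (w 1) (w 0) ∨ d = φ (w 1) (w 2) ∨ d = φ z (w 2) ∨
  d = φ (w 3) y ∨ d = φ (w 3) (w 4) ∨ d = φ (w 5) (w 4) ∨ d = φ (w 5) z

def WellSpreadBridgeGadgets {n : ℕ} (φ : Fin n → Fin n → Fin n) (y z : Fin n)
    (ℬ : Finset (Fin 6 → Fin n)) : Prop :=
  (∀ u : Fin n, u ≠ y → u ≠ z → (ℬ.filter fun w => u ∈ bridgeVerts y z w).card ≤ n) ∧
  (∀ d : Fin n, (ℬ.filter fun w => bridgeHasColour φ y z w d).card ≤ n)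


/-- The number of loops of colour `c`. -/
def loopCount {n : ℕ} (φ : Fin n → Fin n → Fin n) (c : Fin n) : ℕ :=
  Nat.card {i : Fin n // φ i i = c}

/-- For all `v, c`, a well-spread collection of at least `n²/2¹⁰⁰` `(v,c)`-absorbing
gadgets exists. -/
def HasAbsGadgets {n : ℕ} (φ : Fin n → Fin n → Fin n) : Prop :=
  ∀ v c : Fin n, ∃ 𝒜 : Finset (Fin 6 → Fin n),
    (∀ x ∈ 𝒜, IsAbsGadget φ v c x) ∧ WellSpreadAbsGadgets φ v c 𝒜 ∧
    (n : ℝ) ^ 2 / 2 ^ 100 ≤ 𝒜.card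

/-- For all distinct `y, z`, a well-spread collection of at least `n²/10⁵⁰`
`(y,z)`-bridging gadgets exists. -/
def HasBridgeGadgets {n : ℕ} (φ : Fin n → Fin n → Fin n) : Prop :=
  ∀ y z : Fin n, y ≠ z → ∃ ℬ : Finset (Fin 6 → Fin n),
    (∀ w ∈ ℬ, IsBridgeGadget φ y z w) ∧ WellSpreadBridgeGadgets φ y z ℬ ∧
    (n : ℝ) ^ 2 / 10 ^ 50 ≤ ℬ.card

/-! ### `(y,z,𝒫)`-bridges in `𝒢_D` -/

/-- `(D₁, …, D₆)` is an equitable ordered partition of `D` into six parts. -/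
def IsEquitableSixPartition {n : ℕ} (D : Finset (Fin n)) (P : Fin 6 → Finset (Fin n)) :
    Prop :=
  (∀ i, P i ⊆ D) ∧ (∀ i j, i ≠ j → Disjoint (P i) (P j)) ∧
  (Finset.univ.biUnion P = D) ∧ (∀ i j, (P i).card ≤ (P j).card + 1)

/-- A `(y,z,𝒫)`-bridge in `H ∈ 𝒢_D`. -/
def IsBridge {n : ℕ} {D : Finset (Fin n)} (H : GD n D) (y z : Fin n)
    (P : Fin 6 → Finset (Fin n)) (w : Fin 6 → Fin n) : Prop :=
  ([y, z, w 0, w 1, w 2, w 3, w 4, w 5] : List (Fin n)).Nodup ∧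
  ∃ d₁ d₂ d₃ d₄ d₅ d₆ : {d : Fin n // d ∈ D},
    (d₁ : Fin n) ∈ P 0 ∧ (d₂ : Fin n) ∈ P 1 ∧ (d₃ : Fin n) ∈ P 2 ∧
    (d₄ : Fin n) ∈ P 3 ∧ (d₅ : Fin n) ∈ P 4 ∧ (d₆ : Fin n) ∈ P 5 ∧
    H.1 d₁ y = w 0 ∧ H.1 d₁ (w 5) = w 4 ∧
    H.1 d₂ (w 1) = w 0 ∧ H.1 d₂ (w 5) = z ∧
    H.1 d₃ (w 3) = y ∧ H.1 d₃ (w 1) = w 2 ∧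
    H.1 d₄ (w 3) = w 4 ∧ H.1 d₄ z = w 2 ∧
    H.1 d₅ y = w 1 ∧ H.1 d₆ z = w 4

/-- The ten arcs of a `(y,z,𝒫)`-bridge. -/
def bridgeArcsOf {n : ℕ} (y z : Fin n) (w : Fin 6 → Fin n) : Finset (Fin n × Fin n) :=
  {(y, w 0), (w 1, w 0), (w 1, w 2), (z, w 2), (w 3, y), (w 3, w 4), (w 5, w 4), (w 5, z),
   (y, w 1), (z, w 4)}

/-- The four arcs `w₂→w₁, w₂→w₃, w₄→w₅, w₆→w₅` of a bridge. -/
def keyArcsOf {n : ℕ} (w : Fin 6 → Fin n) : Finset (Fin n × Fin n) :=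
  {(w 1, w 0), (w 1, w 2), (w 3, w 4), (w 5, w 4)}

/-- A distinguishable `(y,z,𝒫)`-bridge: the only bridge containing any of its four key arcs. -/
def IsDistinguishableBridge {n : ℕ} {D : Finset (Fin n)} (H : GD n D) (y z : Fin n)
    (P : Fin 6 → Finset (Fin n)) (w : Fin 6 → Fin n) : Prop :=
  IsBridge H y z P w ∧
  ∀ w' : Fin 6 → Fin n, IsBridge H y z P w' →
    ¬ Disjoint (keyArcsOf w) (bridgeArcsOf y z w') → w' = w

/-- `r_{(y,z,𝒫)}(H)`: the number of distinguishable `(y,z,𝒫)`-bridges in `H`. -/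
def distBridgeCount {n : ℕ} {D : Finset (Fin n)} (H : GD n D) (y z : Fin n)
    (P : Fin 6 → Finset (Fin n)) : ℕ :=
  Nat.card {w : Fin 6 → Fin n // IsDistinguishableBridge H y z P w}

/-- Membership in `Q̂_D^{(y,z,𝒫)} = ⋃_{s=0}^{n|D|} M_s^{(y,z,𝒫)}`. -/
def InQhat {n : ℕ} {D : Finset (Fin n)} (H : GD n D) (y z : Fin n)
    (P : Fin 6 → Finset (Fin n)) : Prop :=
  distBridgeCount H y z P ≤ n * D.card ∧
  ∀ A₁ A₂ : Finset (Fin n), A₁.card = D.card → A₂.card = D.card →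
    (eArcs H A₁ A₂ : ℝ) ≤ 2 * (D.card : ℝ) ^ 3 / n + 12 * distBridgeCount H y z P

/-- A `(y,z)`-bridging gadget of `H ∈ 𝒢_D`. -/
def IsBridgeGadgetGD {n : ℕ} {D : Finset (Fin n)} (H : GD n D) (y z : Fin n)
    (w : Fin 6 → Fin n) : Prop :=
  ([y, z, w 0, w 1, w 2, w 3, w 4, w 5] : List (Fin n)).Nodup ∧
  ∃ d₁ d₂ d₃ d₄ : {d : Fin n // d ∈ D},
    ([(d₁ : Fin n), (d₂ : Fin n), (d₃ : Fin n), (d₄ : Fin n)] : List (Fin n)).Nodup ∧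
    H.1 d₁ y = w 0 ∧ H.1 d₁ (w 5) = w 4 ∧
    H.1 d₂ (w 1) = w 0 ∧ H.1 d₂ (w 5) = z ∧
    H.1 d₃ (w 3) = y ∧ H.1 d₃ (w 1) = w 2 ∧
    H.1 d₄ (w 3) = w 4 ∧ H.1 d₄ z = w 2

/-- The gadget (in `H ∈ 𝒢_D`) contains an arc of colour `d`. -/
def bridgeGadgetGDHasColour {n : ℕ} {D : Finset (Fin n)} (H : GD n D) (y z : Fin n)
    (w : Fin 6 → Fin n) (d : Fin n) : Prop :=
  ∃ d' : {d : Fin n // d ∈ D}, (d' : Fin n) = d ∧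
    (H.1 d' y = w 0 ∨ H.1 d' (w 1) = w 0 ∨ H.1 d' (w 1) = w 2 ∨ H.1 d' z = w 2 ∨
     H.1 d' (w 3) = y ∨ H.1 d' (w 3) = w 4 ∨ H.1 d' (w 5) = w 4 ∨ H.1 d' (w 5) = z)

def WellSpreadBridgeGadgetsGD {n : ℕ} {D : Finset (Fin n)} (H : GD n D) (y z : Fin n)
    (ℬ : Finset (Fin 6 → Fin n)) : Prop :=
  (∀ u : Fin n, u ≠ y → u ≠ z → (ℬ.filter fun w => u ∈ bridgeVerts y z w).card ≤ n) ∧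
  (∀ d : Fin n, (ℬ.filter fun w => bridgeGadgetGDHasColour H y z w d).card ≤ n)

/-! ### Directed paths, absorbers, `T`-absorbers -/

/-- The arcs of the directed path whose vertices are the entries of `p`, in order. -/
def pathArcs {n : ℕ} (p : List (Fin n)) : List (Fin n × Fin n) := p.zip p.tail

def pathColours {n : ℕ} (φ : Fin n → Fin n → Fin n) (p : List (Fin n)) : List (Fin n) :=
  (pathArcs p).map fun e => φ e.1 e.2

def internalVerts {n : ℕ} (p : List (Fin n)) : List (Fin n) := (p.drop 1).dropLast

set_option maxHeartbeats 1600000 in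
/-- A `(v,c)`-absorber: a `(v,c)`-absorbing gadget with vertices `x`, bridged by an
`(x₄,x₅)`-bridging gadget with vertices `w`, completed by four rainbow directed paths. -/
structure Absorber (n : ℕ) (φ : Fin n → Fin n → Fin n) (v c : Fin n) where
  x : Fin 6 → Fin n
  w : Fin 6 → Fin n
  P : Fin 4 → List (Fin n)
  gadget : IsAbsGadget φ v c x
  bridge : IsBridgeGadget φ (x 3) (x 4) w
  meetAB : absGadgetVerts v x ∩ bridgeVerts (x 3) (x 4) w = {x 3, x 4}
  colourDisjointAB :
    ∀ d : Fin n, absGadgetHasColour φ v x d → bridgeHasColour φ (x 3) (x 4) w d → False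
  pathNodup : ∀ i, (P i).Nodup
  pathEnds :
    (P 0).head? = some (x 1) ∧ (P 0).getLast? = some (x 2) ∧
    (P 1).head? = some (w 0) ∧ (P 1).getLast? = some (w 3) ∧
    (P 2).head? = some (w 4) ∧ (P 2).getLast? = some (w 1) ∧
    (P 3).head? = some (w 2) ∧ (P 3).getLast? = some (w 5)
  pathsDisjoint : ∀ i j, i ≠ j → ∀ a ∈ P i, a ∉ P j
  pathInternalDisjoint : ∀ i, ∀ a ∈ internalVerts (P i),
    a ∉ absGadgetVerts v x ∧ a ∉ bridgeVerts (x 3) (x 4) w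
  pathsRainbowEach : ∀ i, (pathColours φ (P i)).Nodup
  pathsRainbowPair : ∀ i j, i ≠ j → ∀ d ∈ pathColours φ (P i), d ∉ pathColours φ (P j)
  pathColoursNew : ∀ i, ∀ d ∈ pathColours φ (P i),
    ¬ absGadgetHasColour φ v x d ∧ ¬ bridgeHasColour φ (x 3) (x 4) w d

def Absorber.arcs {n : ℕ} {φ : Fin n → Fin n → Fin n} {v c : Fin n}
    (A : Absorber n φ v c) : Finset (Fin n × Fin n) :=
  ({(A.x 0, v), (v, A.x 1), (A.x 0, A.x 1), (A.x 2, A.x 3), (A.x 2, A.x 4),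
    (A.x 3, A.x 5), (A.x 4, A.x 5)} : Finset (Fin n × Fin n)) ∪
  ({(A.x 3, A.w 0), (A.w 1, A.w 0), (A.w 1, A.w 2), (A.x 4, A.w 2), (A.w 3, A.x 3),
    (A.w 3, A.w 4), (A.w 5, A.w 4), (A.w 5, A.x 4)} : Finset (Fin n × Fin n)) ∪
  Finset.univ.biUnion fun i : Fin 4 => (pathArcs (A.P i)).toFinset

def Absorber.verts {n : ℕ} {φ : Fin n → Fin n → Fin n} {v c : Fin n}
    (A : Absorber n φ v c) : Finset (Fin n) :=
  absGadgetVerts v A.x ∪ bridgeVerts (A.x 3) (A.x 4) A.w ∪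
    Finset.univ.biUnion fun i : Fin 4 => (A.P i).toFinset

def Absorber.colours {n : ℕ} {φ : Fin n → Fin n → Fin n} {v c : Fin n}
    (A : Absorber n φ v c) : Finset (Fin n) :=
  A.arcs.image fun e => φ e.1 e.2

def Absorber.initial {n : ℕ} {φ : Fin n → Fin n → Fin n} {v c : Fin n}
    (A : Absorber n φ v c) : Fin n := A.x 0

def Absorber.terminal {n : ℕ} {φ : Fin n → Fin n → Fin n} {v c : Fin n}
    (A : Absorber n φ v c) : Fin n := A.x 5

/-- A `T`-absorber inside the coloured `K_n^↔`, with arc set `H`. -/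
structure TAbsorber (n : ℕ) (φ : Fin n → Fin n → Fin n) {α β : Type}
    [Fintype α] [Fintype β] [DecidableEq α] [DecidableEq β]
    (T : Finset (α × β)) (H : Finset (Fin n × Fin n)) where
  fV : α → Fin n
  fC : β → Fin n
  fVinj : Function.Injective fV
  fCinj : Function.Injective fC
  fCrange : ∀ b : β, fC b ∈ H.image fun e : Fin n × Fin n => φ e.1 e.2
  Ab : (e : α × β) → e ∈ T → Absorber n φ (fV e.1) (fC e.2)
  AbSub : ∀ e he, (Ab e he).arcs ⊆ H
  AbUnique : ∀ e he (A' : Absorber n φ (fV e.1) (fC e.2)),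
    A'.arcs ⊆ H → A'.arcs = (Ab e he).arcs
  AbVertexDisjoint : ∀ e he e' he', e ≠ e' →
    ∀ u : Fin n, u ∈ (Ab e he).verts → u ∈ (Ab e' he').verts → e.1 = e'.1 ∧ u = fV e.1
  AbColourDisjoint : ∀ e he e' he', e ≠ e' →
    ∀ d : Fin n, d ∈ (Ab e he).colours → d ∈ (Ab e' he').colours → e.2 = e'.2 ∧ d = fC e.2
  es : Fin T.card → α × β
  esInj : Function.Injective es
  esMem : ∀ i, es i ∈ T
  link : Fin (T.card - 1) → List (Fin n)
  linkLen : ∀ i, (link i).length = 4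
  linkNodup : ∀ i, (link i).Nodup
  linkSub : ∀ i, ∀ e ∈ pathArcs (link i), e ∈ H
  linkPairwiseDisjoint : ∀ i j, i ≠ j → ∀ a ∈ link i, a ∉ link j
  linkRainbowEach : ∀ i, (pathColours φ (link i)).Nodup
  linkRainbowPair : ∀ i j, i ≠ j → ∀ d ∈ pathColours φ (link i), d ∉ pathColours φ (link j)
  linkColourNew : ∀ i, ∀ d ∈ pathColours φ (link i), ∀ e he, d ∉ (Ab e he).colours
  linkHead : ∀ i : Fin (T.card - 1),
    (link i).head? = some (Ab (es (Fin.castLE (Nat.sub_le _ _) i)) (esMem _)).terminal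
  linkLast : ∀ i : Fin (T.card - 1),
    (link i).getLast? =
      some (Ab (es ⟨i.1 + 1, by have := i.2; omega⟩) (esMem _)).initial
  linkInternalDisjoint : ∀ i, ∀ a ∈ internalVerts (link i), ∀ e he, a ∉ (Ab e he).verts
  minimal : H = (T.attach.biUnion fun e => (Ab e.1 e.2).arcs) ∪
      (Finset.univ.biUnion fun i => (pathArcs (link i)).toFinset)

def TAbsorber.initialVtx {n : ℕ} {φ : Fin n → Fin n → Fin n} {α β : Type}
    [Fintype α] [Fintype β] [DecidableEq α] [DecidableEq β]
    {T : Finset (α × β)} {H : Finset (Fin n × Fin n)} (𝔸 : TAbsorber n φ T H)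
    (h : 0 < T.card) : Fin n :=
  (𝔸.Ab (𝔸.es ⟨0, h⟩) (𝔸.esMem _)).initial

def TAbsorber.terminalVtx {n : ℕ} {φ : Fin n → Fin n → Fin n} {α β : Type}
    [Fintype α] [Fintype β] [DecidableEq α] [DecidableEq β]
    {T : Finset (α × β)} {H : Finset (Fin n × Fin n)} (𝔸 : TAbsorber n φ T H)
    (h : 0 < T.card) : Fin n :=
  (𝔸.Ab (𝔸.es ⟨T.card - 1, Nat.sub_lt h Nat.one_pos⟩) (𝔸.esMem _)).terminal

/-- `T` (bipartite, edge set a finset of `α × β`) is robustly matchable with respect to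
flexible sets `A'`, `B'`. -/
def RobustlyMatchable {α β : Type} [DecidableEq α] [DecidableEq β]
    (T : Finset (α × β)) (A' : Finset α) (B' : Finset β) : Prop :=
  ∀ X : Finset α, ∀ Y : Finset β, X ⊆ A' → Y ⊆ B' → X.card = Y.card →
    (X.card : ℝ) ≤ min ((A'.card : ℝ) / 2) ((B'.card : ℝ) / 2) →
    ∃ M : Finset (α × β), M ⊆ T ∧ (∀ e ∈ M, e.1 ∉ X ∧ e.2 ∉ Y) ∧
      (∀ a : α, a ∉ X → ∃! e, e ∈ M ∧ e.1 = a) ∧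
      (∀ b : β, b ∉ Y → ∃! e, e ∈ M ∧ e.2 = b)

def arcVerts {n : ℕ} (H : Finset (Fin n × Fin n)) : Finset (Fin n) :=
  H.image Prod.fst ∪ H.image Prod.snd

/-- `H` (an arc set in the coloured `K_n^↔`) is robustly rainbow-Hamiltonian with respect
to flexible sets `Vf`, `Cf` and initial and terminal vertices `u`, `v`. -/
def RobustlyRainbowHam {n : ℕ} (φ : Fin n → Fin n → Fin n) (H : Finset (Fin n × Fin n))
    (Vf Cf : Finset (Fin n)) (u v : Fin n) : Prop :=
  ∀ X Y : Finset (Fin n), X ⊆ Vf → Y ⊆ Cf → X.card = Y.card →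
    (X.card : ℝ) ≤ min ((Vf.card : ℝ) / 2) ((Cf.card : ℝ) / 2) →
    ∃ p : List (Fin n), p.Nodup ∧ p.head? = some u ∧ p.getLast? = some v ∧
      (∀ e ∈ pathArcs p, e ∈ H) ∧
      (∀ a ∈ p, a ∉ X) ∧
      p.toFinset = arcVerts H \ X ∧
      (pathColours φ p).Nodup ∧
      (∀ d ∈ pathColours φ p, d ∉ Y)

/-! ### Lower-quasirandomness and rainbow directed path forests -/

/-- `e_{G,D}(U₁,U₂)`: the number of arcs with tail in `U₁`, head in `U₂`, colour in `D`. -/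
def colArcCount {n : ℕ} (φ : Fin n → Fin n → Fin n) (U₁ U₂ D : Finset (Fin n)) : ℕ :=
  Nat.card {p : Fin n × Fin n // p.1 ∈ U₁ ∧ p.2 ∈ U₂ ∧ φ p.1 p.2 ∈ D}

def LowerQuasirandom {n : ℕ} (φ : Fin n → Fin n → Fin n) : Prop :=
  ∀ U₁ U₂ D : Finset (Fin n),
    (U₁.card : ℝ) * U₂.card * D.card / n - (n : ℝ) ^ (5 / 3 : ℝ) ≤ colArcCount φ U₁ U₂ D

/-- The arc set `Q` contains a directed cycle (a loop counts as a cycle of length one). -/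
def HasDiCycle {n : ℕ} (Q : Finset (Fin n × Fin n)) : Prop :=
  ∃ (a : Fin n) (l : List (Fin n)), (a :: l).Nodup ∧
    List.Chain (fun u v : Fin n => (u, v) ∈ Q) a l ∧
    ((a :: l).getLast (List.cons_ne_nil a l), a) ∈ Q

/-- `Q` is (the arc set of) a spanning rainbow directed path forest of `G − U`, using no
colour of `D`, with at most `n^{9/10}` components. -/
def IsGoodPathForest {n : ℕ} (φ : Fin n → Fin n → Fin n) (U D : Finset (Fin n))
    (Q : Finset (Fin n × Fin n)) : Prop :=
  (∀ e ∈ Q, e.1 ∉ U ∧ e.2 ∉ U) ∧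
  (∀ e ∈ Q, ∀ e' ∈ Q, e ≠ e' → e.1 ≠ e'.1 ∧ e.2 ≠ e'.2) ∧
  ¬ HasDiCycle Q ∧
  Set.InjOn (fun e : Fin n × Fin n => φ e.1 e.2) (Q : Set (Fin n × Fin n)) ∧
  (∀ e ∈ Q, φ e.1 e.2 ∉ D) ∧
  ((n : ℝ) - U.card - Q.card ≤ (n : ℝ) ^ (9 / 10 : ℝ))


/-- A union bound over the `t`-subsets of `Fin n`: at most `n! / t!` permutations have at least
`t` fixed points. -/
theorem card_perm_fixing_mul_factorial_le (n t : ℕ) :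
    (Finset.univ.filter fun σ : Equiv.Perm (Fin n) =>
      t ≤ (Finset.univ.filter fun i => σ i = i).card).card * t.factorial ≤ n.factorial := by
  rcases lt_or_ge n t with h | h
  · rw [Finset.filter_false_of_mem]
    · simp
    · intro σ _ hσ
      have := hσ.trans (Finset.card_le_univ _)
      simp only [Fintype.card_fin] at this
      omega
  have hfix : ∀ S ∈ Finset.powersetCard t (Finset.univ : Finset (Fin n)),
      (Finset.univ.filter fun σ : Equiv.Perm (Fin n) => ∀ i ∈ S, σ i = i).card
        = (n - t).factorial := by
    intro S hS
    rw [Finset.mem_powersetCard] at hS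
    rw [← Fintype.card_subtype]
    have e := Equiv.Perm.subtypeEquivSubtypePerm (fun i : Fin n => i ∉ S)
    simp only [not_not] at e
    rw [← Fintype.card_congr e, Fintype.card_perm, Fintype.card_subtype_compl]
    simp [hS.2]
  have hsub : (Finset.univ.filter fun σ : Equiv.Perm (Fin n) =>
      t ≤ (Finset.univ.filter fun i => σ i = i).card) ⊆
      (Finset.powersetCard t (Finset.univ : Finset (Fin n))).biUnion fun S =>
        Finset.univ.filter fun σ : Equiv.Perm (Fin n) => ∀ i ∈ S, σ i = i := by
    intro σ hσ
    simp only [Finset.mem_filter, Finset.mem_univ, true_and] at hσ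
    obtain ⟨S, hS, hc⟩ := Finset.exists_subset_card_eq hσ
    simp only [Finset.mem_biUnion, Finset.mem_powersetCard, Finset.mem_filter,
      Finset.mem_univ, true_and]
    exact ⟨S, ⟨Finset.subset_univ _, hc⟩, fun i hi => by simpa using hS hi⟩
  have hcard := (Finset.card_le_card hsub).trans Finset.card_biUnion_le
  rw [Finset.sum_congr rfl hfix, Finset.sum_const, Finset.card_powersetCard, Finset.card_univ,
    Fintype.card_fin, smul_eq_mul] at hcard
  calc _ ≤ n.choose t * (n - t).factorial * t.factorial := Nat.mul_le_mul_right _ hcard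
    _ = n.factorial := by
      rw [← Nat.choose_mul_factorial_mul_factorial h]; ring

/-- Permuting the columns of a Latin square. -/
def permuteColumns {n : ℕ} (σ : Equiv.Perm (Fin n)) : LatinSquare n ≃ LatinSquare n where
  toFun L := ⟨fun i j => L.1 i (σ j),
    fun i => (L.2.1 i).comp σ.bijective, fun j => L.2.2 (σ j)⟩
  invFun L := ⟨fun i j => L.1 i (σ.symm j),
    fun i => (L.2.1 i).comp σ.symm.bijective, fun j => L.2.2 (σ.symm j)⟩
  left_inv L := by ext; simp
  right_inv L := by ext; simp

/-- The positions of a given symbol in a Latin square are the graph of a permutation. -/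
theorem IsLatin.exists_perm {n : ℕ} {L : Fin n → Fin n → Fin n} (hL : IsLatin L) (s : Fin n) :
    ∃ π : Equiv.Perm (Fin n), ∀ i j, L i j = s ↔ π i = j := by
  choose f hf using fun i => (hL.1 i).2 s
  have hinj : Function.Injective f := fun i i' h =>
    (hL.2 (f i)).1 (show L i (f i) = L i' (f i) by rw [hf, h, hf])
  refine ⟨Equiv.ofBijective f (Finite.injective_iff_bijective.1 hinj), fun i j => ?_⟩
  rw [Equiv.ofBijective_apply]
  exact ⟨fun h => (hL.1 i).1 ((hf i).trans h.symm), fun h => h ▸ hf i⟩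

theorem IsLatin.card_perm_mul_factorial_le {n : ℕ} {L : Fin n → Fin n → Fin n} (hL : IsLatin L)
    (s : Fin n) (t : ℕ) :
    (Finset.univ.filter fun σ : Equiv.Perm (Fin n) =>
      t ≤ (Finset.univ.filter fun i => L i (σ i) = s).card).card * t.factorial
        ≤ n.factorial := by
  obtain ⟨π, hπ⟩ := hL.exists_perm s
  refine le_trans (le_of_eq ?_) (card_perm_fixing_mul_factorial_le n t)
  congr 1
  refine Finset.card_equiv (Equiv.mulLeft π⁻¹) fun σ => ?_
  have h : ∀ i, L i (σ i) = s ↔ (π⁻¹ * σ) i = i := fun i => by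
    rw [hπ, Equiv.Perm.mul_apply, Equiv.Perm.inv_eq_iff_eq, eq_comm]
  simp only [Finset.mem_filter, Finset.mem_univ, true_and, h, Equiv.coe_mulLeft]

/-- For a uniformly random Latin square, a fixed symbol appears at least `t` times on the leading
diagonal with probability at most `1 / t!`. -/
theorem card_diag_symbol_mul_factorial_le (n t : ℕ) (s : Fin n) :
    (Finset.univ.filter fun L : LatinSquare n =>
      t ≤ (Finset.univ.filter fun i => L.1 i i = s).card).card * t.factorial
        ≤ Fintype.card (LatinSquare n) := by
  set B := Finset.univ.filter fun L : LatinSquare n =>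
    t ≤ (Finset.univ.filter fun i => L.1 i i = s).card with hB
  have hshift : ∀ σ : Equiv.Perm (Fin n), (Finset.univ.filter fun L : LatinSquare n =>
      t ≤ (Finset.univ.filter fun i => L.1 i (σ i) = s).card).card = B.card := by
    intro σ
    refine Finset.card_equiv (permuteColumns σ) fun L => ?_
    simp [hB, permuteColumns]
  have hcount := Finset.sum_card_bipartiteAbove_eq_sum_card_bipartiteBelow
    (s := (Finset.univ : Finset (Equiv.Perm (Fin n))))
    (t := (Finset.univ : Finset (LatinSquare n)))
    (fun σ L => t ≤ (Finset.univ.filter fun i => L.1 i (σ i) = s).card)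
  simp only [Finset.bipartiteAbove, Finset.bipartiteBelow, hshift, Finset.sum_const,
    Finset.card_univ, Fintype.card_perm, Fintype.card_fin, smul_eq_mul] at hcount
  refine Nat.le_of_mul_le_mul_left ?_ n.factorial_pos
  rw [← mul_assoc, hcount, Finset.sum_mul]
  calc _ ≤ ∑ _L : LatinSquare n, n.factorial :=
        Finset.sum_le_sum fun L _ => L.2.card_perm_mul_factorial_le s t
    _ = _ := by simp [mul_comm]

theorem card_le_diagMax_mul_factorial_le {n t : ℕ} (ht : 0 < t) :
    Nat.card {L : LatinSquare n // t ≤ diagMax L.1} * t.factorial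
      ≤ n * Nat.card (LatinSquare n) := by
  rw [Nat.card_eq_fintype_card, Nat.card_eq_fintype_card, Fintype.card_subtype]
  have hsub : (Finset.univ.filter fun L : LatinSquare n => t ≤ diagMax L.1) ⊆
      Finset.univ.biUnion fun s : Fin n => Finset.univ.filter fun L : LatinSquare n =>
        t ≤ (Finset.univ.filter fun i => L.1 i i = s).card := by
    intro L hL
    rw [Finset.mem_filter, diagMax, Finset.le_sup_iff ht] at hL
    simpa using hL
  calc _ ≤ (∑ s : Fin n, (Finset.univ.filter fun L : LatinSquare n =>
        t ≤ (Finset.univ.filter fun i => L.1 i i = s).card).card) * t.factorial :=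
        Nat.mul_le_mul_right _ ((Finset.card_le_card hsub).trans Finset.card_biUnion_le)
    _ ≤ ∑ _s : Fin n, Fintype.card (LatinSquare n) := by
        rw [Finset.sum_mul]
        exact Finset.sum_le_sum fun s _ => card_diag_symbol_mul_factorial_le n t s
    _ = _ := by simp

theorem le_mul_log_of_log_log_large {y t : ℝ} (hy : 0 < y) (hm : 100 ≤ Real.log y)
    (ht : 3 * y / Real.log y ≤ t) : y ≤ 3 / 4 * (t * Real.log t) - t := by
  set m := Real.log y with hmdef
  have hm0 : 0 < m := by linarith
  have hq : 0 < 3 * y / m := by positivity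
  have hlogm : Real.log m ≤ m / 8 + 6 := by
    have h1 := Real.log_le_sub_one_of_pos (show 0 < m / 8 by positivity)
    have h2 := Real.log_le_sub_one_of_pos (show (0 : ℝ) < 8 by norm_num)
    rw [Real.log_div hm0.ne' (by norm_num)] at h1
    linarith
  have hlogt : m - Real.log m ≤ Real.log t := by
    rw [hmdef, ← Real.log_div hy.ne' hm0.ne']
    refine Real.log_le_log (by positivity) (le_trans ?_ ht)
    gcongr
    linarith
  have hfac : m / 3 ≤ 3 / 4 * Real.log t - 1 := by linarith
  have ht0 : 0 ≤ t := hq.le.trans ht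
  calc y = 3 * y / m * (m / 3) := by field_simp
    _ ≤ t * (3 / 4 * Real.log t - 1) := by gcongr
    _ = _ := by ring

theorem mul_log_sub_le_log_factorial {t : ℕ} (ht : 0 < t) :
    t * Real.log t - t ≤ Real.log t.factorial := by
  have ht' : (0 : ℝ) < t := by exact_mod_cast ht
  have hf : (0 : ℝ) < t.factorial := by exact_mod_cast t.factorial_pos
  have h := Real.log_le_log (by positivity) (Real.pow_div_factorial_le_exp (t : ℝ) ht'.le t)
  rw [Real.log_exp, Real.log_div (by positivity) hf.ne', Real.log_pow] at h
  linarith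

/-- For a uniformly random `n × n` Latin square, the maximum number `X`
of appearances of any symbol on the leading diagonal satisfies
`P[X ≥ t] ≤ exp(-a t log t)` whenever `t ≥ 3 log n / log log n`. -/
theorem statement_3 :
    ∃ a : ℝ, 0 < a ∧ ∃ n₀ : ℕ, ∀ n : ℕ, n₀ ≤ n → ∀ t : ℕ,
      3 * Real.log n / Real.log (Real.log n) ≤ t →
      (Nat.card {L : LatinSquare n // t ≤ diagMax L.1} : ℝ) ≤
        Real.exp (-(a * t * Real.log t)) * Nat.card (LatinSquare n) := by
  refine ⟨1 / 4, by norm_num, ⌈Real.exp (Real.exp 100)⌉₊, fun n hn t ht => ?_⟩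
  have hn' : Real.exp (Real.exp 100) ≤ n := Nat.ceil_le.1 hn
  have hn0 : (0 : ℝ) < n := (Real.exp_pos _).trans_le hn'
  have hlog : Real.exp 100 ≤ Real.log n := (Real.le_log_iff_exp_le hn0).2 hn'
  have hlog0 : 0 < Real.log n := (Real.exp_pos _).trans_le hlog
  have hloglog : 100 ≤ Real.log (Real.log n) := (Real.le_log_iff_exp_le hlog0).2 hlog
  have ht0 : 0 < t := by
    have : (0 : ℝ) < t := lt_of_lt_of_le (by positivity) ht
    exact_mod_cast this
  have hf : (0 : ℝ) < t.factorial := by exact_mod_cast t.factorial_pos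
  have hbound : (n : ℝ) ≤ Real.exp (-(1 / 4 * t * Real.log t)) * t.factorial := by
    rw [← Real.exp_log hn0, ← Real.exp_log hf, ← Real.exp_add, Real.exp_le_exp]
    have h1 := le_mul_log_of_log_log_large hlog0 hloglog ht
    have h2 := mul_log_sub_le_log_factorial ht0
    linarith
  have hcard : (Nat.card {L : LatinSquare n // t ≤ diagMax L.1} : ℝ) * t.factorial
      ≤ n * Nat.card (LatinSquare n) := by
    exact_mod_cast card_le_diagMax_mul_factorial_le ht0
  refine le_of_mul_le_mul_right (hcard.trans ?_) hf
  calc (n : ℝ) * Nat.card (LatinSquare n)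
      ≤ Real.exp (-(1 / 4 * t * Real.log t)) * t.factorial * Nat.card (LatinSquare n) := by
        gcongr
    _ = _ := by ring

end RandomLatin
end
end

section
/- For n×n Latin squares with symbols [n], write L ~ L' if L' can be obtained from L by permuting the rows; this is an equivalence relation on the set of n×n Latin squares. There exist constants a > 0 and n₀ such that the following holds for all n ≥ n₀: for every equivalence class S of ~, if L is chosen uniformly at random from S and X(L) = max over s ∈ [n] of |{i ∈ [n] : L(i,i) = s}|, then for every t with t ≥ 3 log n / log log n, the probability that X(L) ≥ t is at most exp(−a·t·log t). -/
open scoped Classical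

noncomputable section

namespace RandomLatin

/-- At most `(n - |T|)!` row permutations place the symbol `s` at every diagonal position
of `T`. -/
lemma card_perm_constant_on_le {n : ℕ} {L : Fin n → Fin n → Fin n} (hL : IsLatin L)
    (s : Fin n) (T : Finset (Fin n)) :
    (Finset.univ.filter fun σ : Equiv.Perm (Fin n) => ∀ i ∈ T, L (σ i) i = s).card ≤
      (n - T.card).factorial := by
  rcases (Finset.univ.filter fun σ : Equiv.Perm (Fin n) =>
    ∀ i ∈ T, L (σ i) i = s).eq_empty_or_nonempty with h | ⟨σ₀, h₀⟩
  · simp [h]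
  have hfix : Fintype.card {f : Equiv.Perm (Fin n) // ∀ a, ¬ (a ∉ T) → f a = a} =
      (n - T.card).factorial := by
    rw [← Fintype.card_congr (Equiv.Perm.subtypeEquivSubtypePerm fun a => a ∉ T),
      Fintype.card_perm, Fintype.card_subtype_compl]
    simp
  rw [← hfix, Fintype.card_subtype]
  refine Finset.card_le_card_of_injOn (fun σ => σ₀⁻¹ * σ) (fun σ hσ => ?_)
    (fun σ _ τ _ h => mul_left_cancel h)
  simp only [Finset.coe_filter, Finset.mem_univ, true_and, Set.mem_ofPred_eq, not_not,
    Finset.mem_filter] at hσ h₀ ⊢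
  intro i hi
  have : σ i = σ₀ i := (hL.2 i).1 ((hσ i hi).trans (h₀ i hi).symm)
  simp [Equiv.Perm.mul_apply, this]

/-- A union bound over symbols and `t`-sets of diagonal positions. -/
lemma card_diagMax_mul_factorial_le {n : ℕ} (L : LatinSquare n) {t : ℕ} (ht : 0 < t) :
    Nat.card {σ : Equiv.Perm (Fin n) // t ≤ diagMax fun i j => L.1 (σ i) j} * t.factorial ≤
      n * n.factorial := by
  have hcover : (Finset.univ.filter fun σ : Equiv.Perm (Fin n) =>
      t ≤ diagMax fun i j => L.1 (σ i) j) ⊆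
      (Finset.univ ×ˢ Finset.powersetCard t Finset.univ).biUnion
        fun p : Fin n × Finset (Fin n) => Finset.univ.filter
          fun σ : Equiv.Perm (Fin n) => ∀ i ∈ p.2, L.1 (σ i) i = p.1 := by
    intro σ hσ
    obtain ⟨s, -, hs⟩ := (Finset.le_sup_iff (by simpa using ht)).1 (Finset.mem_filter.1 hσ).2
    obtain ⟨T, hT, hcard⟩ := Finset.exists_subset_card_eq hs
    simp only [Finset.mem_biUnion, Finset.mem_product, Finset.mem_univ, true_and,
      Finset.mem_powersetCard, Finset.mem_filter]
    exact ⟨(s, T), ⟨Finset.subset_univ _, hcard⟩, fun i hi => (Finset.mem_filter.1 (hT hi)).2⟩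
  have hcount : Nat.card {σ : Equiv.Perm (Fin n) // t ≤ diagMax fun i j => L.1 (σ i) j} ≤
      n * n.choose t * (n - t).factorial := by
    rw [Nat.card_eq_fintype_card, Fintype.card_subtype]
    refine (Finset.card_le_card hcover).trans
      ((Finset.card_biUnion_le_card_mul _ _ (n - t).factorial fun p hp => ?_).trans_eq ?_)
    · have hp' := (Finset.mem_powersetCard.1 (Finset.mem_product.1 hp).2).2
      exact hp' ▸ card_perm_constant_on_le L.2 p.1 p.2
    · simp [Finset.card_product]
  rcases le_or_gt t n with h | h
  · calc _ ≤ n * n.choose t * (n - t).factorial * t.factorial := Nat.mul_le_mul_right _ hcount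
      _ = n * n.factorial := by rw [← Nat.choose_mul_factorial_mul_factorial h]; ring
  · rw [Nat.choose_eq_zero_of_lt h] at hcount
    simp only [mul_zero, zero_mul, Nat.le_zero] at hcount
    rw [hcount, zero_mul]
    exact Nat.zero_le _

/-- If `t ≥ 3 log n / log log n` and `n` is large, then `n / t! ≤ exp (-(t log t) / 4)`. -/
lemma eventually_le_exp_mul_factorial :
    ∀ᶠ n : ℕ in Filter.atTop, ∀ t : ℕ, 3 * Real.log n / Real.log (Real.log n) ≤ t →
      0 < t ∧ (n : ℝ) ≤ Real.exp (-(1 / 4 * t * Real.log t)) * t.factorial := by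
  have hlog : Filter.Tendsto (fun n : ℕ => Real.log n) Filter.atTop Filter.atTop :=
    Real.tendsto_log_atTop.comp tendsto_natCast_atTop_atTop
  have hloglog := Real.tendsto_log_atTop.comp hlog
  have hlittle : ∀ᶠ y : ℝ in Filter.atTop, Real.log y ≤ 1 / 3 * y := by
    filter_upwards [Real.isLittleO_log_id_atTop.def (by norm_num : (0 : ℝ) < 1 / 3),
      Filter.eventually_ge_atTop 0] with y hy hy0
    simp only [id, Real.norm_eq_abs, abs_of_nonneg hy0] at hy
    exact (le_abs_self _).trans hy
  filter_upwards [hlog.eventually_ge_atTop 1, hloglog.eventually_ge_atTop 6,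
    hloglog.eventually hlittle, Filter.eventually_gt_atTop 0] with n hx hy hlogy hn t ht
  simp only [Function.comp_apply] at hy hlogy
  set x := Real.log n
  set y := Real.log x
  have hy0 : 0 < y := by linarith
  have hq : 0 < x / y := by positivity
  have hqt : x / y ≤ t := by
    have h : 3 * x / y = 3 * (x / y) := by ring
    linarith
  have ht0 : (0 : ℝ) < t := hq.trans_le hqt
  refine ⟨by exact_mod_cast ht0, ?_⟩
  have hlogt : 2 / 3 * y ≤ Real.log t := by
    have h := Real.log_le_log hq hqt
    rw [Real.log_div (by linarith) hy0.ne'] at h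
    linarith
  have hxt : 3 * x ≤ t * y := by rwa [div_le_iff₀ hy0] at ht
  have hfact : Real.exp (t * Real.log t - t) ≤ t.factorial := by
    have h := Real.pow_div_factorial_le_exp (t : ℝ) ht0.le t
    rw [div_le_iff₀ (by positivity)] at h
    rw [Real.exp_sub, div_le_iff₀ (Real.exp_pos _), mul_comm (t : ℝ), Real.exp_mul,
      Real.exp_log ht0, Real.rpow_natCast]
    linarith
  calc (n : ℝ) = Real.exp x := (Real.exp_log (by exact_mod_cast hn)).symm
    _ ≤ Real.exp (-(1 / 4 * t * Real.log t) + (t * Real.log t - t)) := by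
      apply Real.exp_le_exp.2
      nlinarith [mul_le_mul_of_nonneg_left hlogt ht0.le, mul_le_mul_of_nonneg_left hy ht0.le]
    _ = Real.exp (-(1 / 4 * t * Real.log t)) * Real.exp (t * Real.log t - t) := Real.exp_add _ _
    _ ≤ _ := by gcongr

/-- The same diagonal bound holds for a Latin square chosen uniformly
from any equivalence class under row permutations: choosing a uniformly random row
permutation `σ` of an arbitrary Latin square `L`, the row-permuted square
`(i,j) ↦ L (σ i) j` satisfies `P[X ≥ t] ≤ exp(-a t log t)` for `t ≥ 3 log n / log log n`. -/
theorem statement_4 :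
    ∃ a : ℝ, 0 < a ∧ ∃ n₀ : ℕ, ∀ n : ℕ, n₀ ≤ n → ∀ L : LatinSquare n, ∀ t : ℕ,
      3 * Real.log n / Real.log (Real.log n) ≤ t →
      (Nat.card {σ : Equiv.Perm (Fin n) //
          t ≤ diagMax fun i j => L.1 (σ i) j} : ℝ) ≤
        Real.exp (-(a * t * Real.log t)) * Nat.card (Equiv.Perm (Fin n)) := by
  obtain ⟨n₀, hn₀⟩ := Filter.eventually_atTop.1 eventually_le_exp_mul_factorial
  refine ⟨1 / 4, by norm_num, n₀, fun n hn L t ht => ?_⟩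
  obtain ⟨ht0, hbound⟩ := hn₀ n hn t ht
  have hcard := card_diagMax_mul_factorial_le L ht0
  rw [Nat.card_eq_fintype_card (α := Equiv.Perm (Fin n)), Fintype.card_perm, Fintype.card_fin]
  refine le_of_mul_le_mul_right (a := (t.factorial : ℝ)) ?_ (by positivity)
  calc _ ≤ (n : ℝ) * n.factorial := by exact_mod_cast hcard
    _ ≤ Real.exp (-(1 / 4 * t * Real.log t)) * t.factorial * n.factorial := by gcongr
    _ = _ := by ring

end RandomLatin
end
end

section
/- There exists a constant C > 0 such that for every n ≥ 2, every D ⊆ [n], and all H, H' ∈ 𝒢_D, we have comp(H) ≤ exp(C·n·(log n)²)·comp(H'). -/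
open scoped Classical

noncomputable section

namespace RandomLatin

section Permanent

open MvPolynomial

theorem eval_smul_of_isHomogeneous {k m : ℕ} {p : MvPolynomial (Fin k) ℂ}
    (hp : p.IsHomogeneous m) (w : ℂ) (z : Fin k → ℂ) :
    eval (w • z) p = w ^ m * eval z p := by
  rw [eval_eq', eval_eq', Finset.mul_sum]
  refine Finset.sum_congr rfl fun d hd => ?_
  have h : ∑ i, d i = m := by
    rw [hp.degree_eq_sum_deg_support hd]
    exact (Finset.sum_subset (Finset.subset_univ _) fun i _ hi => by simpa using hi).symm
  simp only [Pi.smul_apply, smul_eq_mul, mul_pow, Finset.prod_mul_distrib,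
    Finset.prod_pow_eq_pow_sum, h]
  ring

/-- `p` does not vanish at nonzero points whose nonzero coordinates have positive real part. -/
def IsStable {k : ℕ} (p : MvPolynomial (Fin k) ℂ) : Prop :=
  ∀ z : Fin k → ℂ, (∀ j, z j = 0 ∨ 0 < (z j).re) → z ≠ 0 → eval z p ≠ 0

theorem IsStable.eval_ne_zero_of_smul {k m : ℕ} {p : MvPolynomial (Fin k) ℂ}
    (hs : IsStable p) (hp : p.IsHomogeneous m) {z : Fin k → ℂ} {w : ℂ} (hw : w ≠ 0)
    (hz : ∀ j, z j = 0 ∨ 0 < (w * z j).re) (h0 : z ≠ 0) : eval z p ≠ 0 := by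
  intro h
  refine hs (w • z) (fun j => ?_) (smul_ne_zero hw h0) ?_
  · rcases hz j with h | h
    · left; simp [h]
    · right; simpa using h
  · rw [eval_smul_of_isHomogeneous hp, h, mul_zero]

/-- The restriction of `p` to the line through `(0, x)` in the direction of the first variable. -/
def lineRestriction {k : ℕ} (p : MvPolynomial (Fin (k + 1)) ℂ) (x : Fin k → ℂ) :
    Polynomial ℂ :=
  Polynomial.map (eval x) (finSuccEquiv ℂ k p)

theorem eval_lineRestriction {k : ℕ} (p : MvPolynomial (Fin (k + 1)) ℂ) (x : Fin k → ℂ) (t : ℂ) :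
    (lineRestriction p x).eval t = eval (Fin.cons t x : Fin (k + 1) → ℂ) p :=
  (eval_eq_eval_mv_eval' x t p).symm

theorem coeff_lineRestriction {k : ℕ} (p : MvPolynomial (Fin (k + 1)) ℂ) (x : Fin k → ℂ) (i : ℕ) :
    (lineRestriction p x).coeff i = eval x ((finSuccEquiv ℂ k p).coeff i) := by
  simp [lineRestriction]

theorem eval_derivative_lineRestriction_zero {k : ℕ} (p : MvPolynomial (Fin (k + 1)) ℂ)
    (x : Fin k → ℂ) :
    (Polynomial.derivative (lineRestriction p x)).eval 0 =
      eval x ((finSuccEquiv ℂ k p).coeff 1) := by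
  rw [← Polynomial.coeff_zero_eq_eval_zero, Polynomial.coeff_derivative, coeff_lineRestriction]
  simp

theorem eval_zero_of_isHomogeneous {k m : ℕ} {p : MvPolynomial (Fin k) ℂ}
    (hp : p.IsHomogeneous m) (hm : m ≠ 0) : eval (0 : Fin k → ℂ) p = 0 := by
  have := eval_smul_of_isHomogeneous hp 0 0
  simpa [hm] using this

theorem eval_lineRestriction_zero {k m : ℕ} {p : MvPolynomial (Fin (k + 1)) ℂ}
    (hp : p.IsHomogeneous m) (x : Fin k → ℂ) :
    (lineRestriction p 0).eval 1 = (lineRestriction p x).coeff m := by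
  have h0 : (finSuccEquiv ℂ k p).coeff m = C (coeff 0 ((finSuccEquiv ℂ k p).coeff m)) :=
    totalDegree_eq_zero_iff_eq_C.1 (Nat.le_zero.1
      (hp.finSuccEquiv_coeff_isHomogeneous m 0 rfl).totalDegree_le)
  have hc : ∀ i, i ≠ m → (lineRestriction p 0).coeff i = 0 := by
    intro i hi
    rw [coeff_lineRestriction]
    rcases lt_or_gt_of_ne hi with h | h
    · exact eval_zero_of_isHomogeneous
        (hp.finSuccEquiv_coeff_isHomogeneous i (m - i) (by omega)) (by omega)
    · have : (finSuccEquiv ℂ k p).coeff i = 0 := by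
        ext d
        rw [finSuccEquiv_coeff_coeff, coeff_zero]
        refine hp.coeff_eq_zero fun hd => ?_
        have : (Finsupp.cons i d).degree = i + d.degree := by
          simp [Finsupp.degree_eq_sum, Fin.sum_univ_succ]
        omega
      simp [this]
  have : lineRestriction p 0 = Polynomial.C ((lineRestriction p 0).coeff m) * Polynomial.X ^ m := by
    ext i
    rw [Polynomial.coeff_C_mul_X_pow]
    split_ifs with h
    · rw [h]
    · exact hc i h
  rw [this, coeff_lineRestriction, coeff_lineRestriction, h0]
  simp

theorem IsStable.natDegree_lineRestriction_ne_zero {k m : ℕ} {p : MvPolynomial (Fin (k + 1)) ℂ}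
    (hs : IsStable p) (hp : p.IsHomogeneous m) (hm : m ≠ 0) (x : Fin k → ℂ) :
    (lineRestriction p x).natDegree ≠ 0 := by
  have h : (lineRestriction p x).coeff m ≠ 0 := by
    rw [← eval_lineRestriction_zero hp, eval_lineRestriction]
    refine hs _ (fun j => ?_) fun h => ?_
    · refine Fin.cases ?_ (fun j => ?_) j <;> simp
    · simpa using congrFun h 0
  have := Polynomial.le_natDegree_of_ne_zero h
  omega

theorem cons_ne_zero_of_ne_zero {k : ℕ} {x : Fin k → ℂ} (hx : x ≠ 0) (t : ℂ) :
    (Fin.cons t x : Fin (k + 1) → ℂ) ≠ 0 := fun h =>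
  hx (funext fun j => by simpa using congrFun h j.succ)

theorem re_neg_of_mem_roots_lineRestriction {k m : ℕ} {p : MvPolynomial (Fin (k + 1)) ℂ}
    (hs : IsStable p) (hp : p.IsHomogeneous m) {x : Fin k → ℂ}
    (hx : ∀ j, x j = 0 ∨ 0 < (x j).re) (h0 : x ≠ 0) {ρ : ℂ}
    (hρ : (lineRestriction p x).eval ρ = 0) : ρ.re < 0 := by
  rw [eval_lineRestriction] at hρ
  by_contra! hre
  have hev : ∀ᶠ ε : ℝ in nhdsWithin 0 (Set.Ioi 0), ∀ j, x j = 0 ∨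
      0 < (x j).re + ε * ρ.im * (x j).im := by
    refine Filter.eventually_all.2 fun j => ?_
    rcases hx j with h | h
    · exact Filter.Eventually.of_forall fun _ => Or.inl h
    · have hc : Filter.Tendsto (fun ε : ℝ => (x j).re + ε * ρ.im * (x j).im)
          (nhdsWithin 0 (Set.Ioi 0)) (nhds ((x j).re + 0 * ρ.im * (x j).im)) :=
        (Continuous.tendsto (by fun_prop) 0).mono_left nhdsWithin_le_nhds
      refine (hc.eventually_const_lt (by simpa using h)).mono fun _ => Or.inr
  obtain ⟨ε, hε, hεpos⟩ := (hev.and self_mem_nhdsWithin).exists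
  have hεpos : 0 < ε := hεpos
  refine hs.eval_ne_zero_of_smul hp (w := ⟨1, -(ε * ρ.im)⟩) ?_ (fun j => ?_)
    (cons_ne_zero_of_ne_zero h0 ρ) hρ
  · intro h
    simpa using congrArg Complex.re h
  · refine Fin.cases ?_ (fun j => ?_) j
    · simp only [Fin.cons_zero, Complex.mul_re]
      by_cases hz : ρ = 0
      · exact Or.inl hz
      · right
        by_cases him : ρ.im = 0
        · have : ρ.re ≠ 0 := fun h => hz (Complex.ext h him)
          have := lt_of_le_of_ne hre this.symm
          simp [him, this]
        · have : 0 < ε * (ρ.im * ρ.im) := mul_pos hεpos (mul_self_pos.2 him)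
          nlinarith
    · simp only [Fin.cons_succ, Complex.mul_re]
      refine (hε j).imp id fun h => ?_
      linarith

theorem IsStable.coeff_one {k m : ℕ} {p : MvPolynomial (Fin (k + 1)) ℂ}
    (hs : IsStable p) (hp : p.IsHomogeneous m) (hm : m ≠ 0) :
    IsStable ((finSuccEquiv ℂ k p).coeff 1) := by
  intro x hx h0
  set R := lineRestriction p x with hR
  have hR0 : R.eval 0 ≠ 0 := fun h => by
    simpa using re_neg_of_mem_roots_lineRestriction hs hp hx h0 h
  have hlog := (IsAlgClosed.splits R).eval_derivative_div_eval_of_ne_zero hR0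
  rw [← eval_derivative_lineRestriction_zero]
  intro h
  rw [h, zero_div] at hlog
  have hdeg : 0 < Multiset.card R.roots := by
    rw [← (IsAlgClosed.splits R).natDegree_eq_card_roots]
    exact Nat.pos_of_ne_zero (hs.natDegree_lineRestriction_ne_zero hp hm x)
  have key : ∀ s : Multiset ℂ, (∀ ρ ∈ s, ρ.re < 0) → 0 < Multiset.card s →
      0 < (s.map fun z => 1 / (0 - z)).sum.re := by
    intro s
    induction s using Multiset.induction with
    | empty => simp
    | cons a s ih =>
      intro hs _
      have ha : 0 < (1 / (0 - a)).re := by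
        have hneg := hs a (Multiset.mem_cons_self a s)
        have hne : a ≠ 0 := fun h => by simp [h] at hneg
        rw [zero_sub, one_div, Complex.inv_re, Complex.neg_re]
        exact div_pos (by linarith) (Complex.normSq_pos.2 (neg_ne_zero.2 hne))
      rw [Multiset.map_cons, Multiset.sum_cons, Complex.add_re]
      rcases Nat.eq_zero_or_pos (Multiset.card s) with h | h
      · rw [Multiset.card_eq_zero.1 h]; simpa using ha
      · exact add_pos ha (ih (fun ρ hρ => hs ρ (Multiset.mem_cons_of_mem hρ)) h)
  have := key R.roots (fun ρ hρ =>
    re_neg_of_mem_roots_lineRestriction hs hp hx h0 (Polynomial.isRoot_of_mem_roots hρ)) hdeg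
  rw [← hlog] at this
  simp at this

theorem real_of_mem_roots_lineRestriction {k m : ℕ} {p : MvPolynomial (Fin (k + 1)) ℂ}
    (hs : IsStable p) (hp : p.IsHomogeneous m) {x : Fin k → ℝ}
    (hx : ∀ j, 0 < x j) {ρ : ℂ} (h0 : (fun j => (x j : ℂ)) ≠ 0)
    (hρ : (lineRestriction p fun j => (x j : ℂ)).eval ρ = 0) : ρ.im = 0 := by
  have hneg := re_neg_of_mem_roots_lineRestriction hs hp (fun j => by simp [hx j]) h0 hρ
  rw [eval_lineRestriction] at hρ
  by_contra him
  refine hs.eval_ne_zero_of_smul hp (w := ⟨1, -((1 - ρ.re) / ρ.im)⟩) ?_ (fun j => ?_)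
    (cons_ne_zero_of_ne_zero h0 ρ) hρ
  · intro h
    simpa using congrArg Complex.re h
  · right
    refine Fin.cases ?_ (fun j => ?_) j
    · simp only [Fin.cons_zero, Complex.mul_re]
      have : (1 - ρ.re) / ρ.im * ρ.im = 1 - ρ.re := div_mul_cancel₀ _ him
      linarith
    · simp [Complex.mul_re, hx j]

/-- A univariate polynomial with negative real roots is dominated by the exponential having
the same value and derivative at the origin. -/
theorem norm_eval_le_of_roots_neg {R : Polynomial ℂ} (h0 : R.eval 0 ≠ 0)
    (hroots : ∀ ρ ∈ R.roots, ρ.im = 0 ∧ ρ.re < 0) {t : ℝ} (ht : 0 ≤ t) :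
    ‖R.eval (t : ℂ)‖ ≤ ‖R.eval 0‖ *
      Real.exp (t * (‖(Polynomial.derivative R).eval 0‖ / ‖R.eval 0‖)) := by
  have hsp := IsAlgClosed.splits R
  rw [← norm_div, hsp.eval_derivative_div_eval_of_ne_zero h0, hsp.eval_eq_prod_roots,
    hsp.eval_eq_prod_roots, norm_mul, norm_mul, mul_assoc]
  refine mul_le_mul_of_nonneg_left ?_ (norm_nonneg _)
  have key : ∀ s : Multiset ℂ, (∀ ρ ∈ s, ρ.im = 0 ∧ ρ.re < 0) →
      0 ≤ (s.map fun z => 1 / (0 - z)).sum.re ∧ (s.map fun z => 1 / (0 - z)).sum.im = 0 ∧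
      ‖(s.map fun z => (t : ℂ) - z).prod‖ ≤ ‖(s.map fun z => 0 - z).prod‖ *
        Real.exp (t * (s.map fun z => 1 / (0 - z)).sum.re) := by
    intro s
    induction s using Multiset.induction with
    | empty => simp
    | cons a s ih =>
      intro hs
      obtain ⟨h1, h2, h3⟩ := ih fun ρ hρ => hs ρ (Multiset.mem_cons_of_mem hρ)
      obtain ⟨him, hre⟩ := hs a (Multiset.mem_cons_self a s)
      obtain ⟨r, hr, rfl⟩ : ∃ r : ℝ, 0 < r ∧ a = ((-r : ℝ) : ℂ) :=
        ⟨-a.re, by linarith, Complex.ext (by simp) (by simp [him])⟩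
      have hinv : (1 / (0 - ((-r : ℝ) : ℂ))) = ((1 / r : ℝ) : ℂ) := by
        push_cast; simp
      simp only [Multiset.map_cons, Multiset.sum_cons, Multiset.prod_cons, hinv, Complex.add_re,
        Complex.add_im, Complex.ofReal_re, Complex.ofReal_im, norm_mul]
      refine ⟨by positivity, by simpa using h2, ?_⟩
      have e1 : ‖(t : ℂ) - ((-r : ℝ) : ℂ)‖ = t + r := by
        rw [← Complex.ofReal_sub, Complex.norm_real, Real.norm_of_nonneg (by linarith)]; ring
      have e2 : ‖(0 : ℂ) - ((-r : ℝ) : ℂ)‖ = r := by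
        rw [← Complex.ofReal_zero, ← Complex.ofReal_sub, Complex.norm_real,
          Real.norm_of_nonneg (by linarith)]; ring
      rw [e1, e2, mul_add, Real.exp_add]
      have : t + r ≤ r * Real.exp (t * (1 / r)) := by
        have := Real.add_one_le_exp (t * (1 / r))
        calc t + r = r * (t * (1 / r) + 1) := by field_simp
          _ ≤ _ := mul_le_mul_of_nonneg_left this hr.le
      calc _ ≤ (r * Real.exp (t * (1 / r))) * (‖(s.map fun z => 0 - z).prod‖ *
            Real.exp (t * (s.map fun z => 1 / (0 - z)).sum.re)) :=
            mul_le_mul this h3 (norm_nonneg _) (by positivity)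
        _ = _ := by ring
  obtain ⟨h1, h2, h3⟩ := key R.roots hroots
  have : ‖(R.roots.map fun z => 1 / (0 - z)).sum‖ = (R.roots.map fun z => 1 / (0 - z)).sum.re := by
    rw [← abs_of_nonneg h1, Complex.abs_re_eq_norm.2 h2]
  rwa [this]

theorem norm_derivative_ge_of_roots_neg {R : Polynomial ℂ} (h0 : R.eval 0 ≠ 0)
    (hd : (Polynomial.derivative R).eval 0 ≠ 0)
    (hroots : ∀ ρ ∈ R.roots, ρ.im = 0 ∧ ρ.re < 0) {c : ℝ}
    (hc : ∀ t : ℝ, 0 < t → c * t ≤ ‖R.eval (t : ℂ)‖) :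
    c * Real.exp (-1) ≤ ‖(Polynomial.derivative R).eval 0‖ := by
  set a := ‖R.eval 0‖ with ha
  set b := ‖(Polynomial.derivative R).eval 0‖ with hb
  have ha0 : 0 < a := norm_pos_iff.2 h0
  have hb0 : 0 < b := norm_pos_iff.2 hd
  have h := (hc (a / b) (by positivity)).trans
    (norm_eval_le_of_roots_neg h0 hroots (t := a / b) (by positivity))
  rw [← ha, ← hb, show a / b * (b / a) = 1 by field_simp] at h
  have : c ≤ b * Real.exp 1 := by
    have h' := mul_le_mul_of_nonneg_right h (by positivity : 0 ≤ b / a)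
    calc c = c * (a / b) * (b / a) := by field_simp
      _ ≤ _ := h'
      _ = _ := by field_simp
  calc c * Real.exp (-1) ≤ b * Real.exp 1 * Real.exp (-1) := by gcongr
    _ = b := by rw [mul_assoc, ← Real.exp_add]; simp

/-- A capacity lower bound for the square-free coefficient of a stable polynomial. -/
theorem IsStable.capacity_le_coeff : ∀ {k : ℕ} {p : MvPolynomial (Fin k) ℂ}, IsStable p →
    p.IsHomogeneous k → ∀ {c : ℝ}, 0 ≤ c →
    (∀ x : Fin k → ℝ, (∀ j, 0 < x j) → c * ∏ j, x j ≤ ‖eval (fun j => (x j : ℂ)) p‖) →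
    c * Real.exp (-k) ≤ ‖coeff (Finsupp.equivFunOnFinite.symm fun _ => 1) p‖
  | 0, p, _, _, c, _, hc => by
    have h := hc Fin.elim0 fun j => j.elim0
    rw [eq_C_of_isEmpty p] at h ⊢
    have e : (Finsupp.equivFunOnFinite.symm fun _ : Fin 0 => 1) = 0 := Subsingleton.elim _ _
    rw [e]
    simpa using h
  | k + 1, p, hs, hp, c, hc0, hc => by
    set q := (finSuccEquiv ℂ k p).coeff 1 with hq
    have hqs : IsStable q := hs.coeff_one hp (by omega)
    have hqh : q.IsHomogeneous k := hp.finSuccEquiv_coeff_isHomogeneous 1 k (by omega)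
    have hcoeff : coeff (Finsupp.equivFunOnFinite.symm fun _ : Fin (k + 1) => 1) p =
        coeff (Finsupp.equivFunOnFinite.symm fun _ : Fin k => 1) q := by
      rw [hq, finSuccEquiv_coeff_coeff]
      congr 1
      ext j
      refine Fin.cases ?_ (fun j => ?_) j <;> simp
    rw [hcoeff]
    have hstep : ∀ x : Fin k → ℝ, (∀ j, 0 < x j) →
        c * Real.exp (-1) * ∏ j, x j ≤ ‖eval (fun j => (x j : ℂ)) q‖ := by
      intro x hx
      have hR : ∀ t : ℝ, 0 < t → (c * ∏ j, x j) * t ≤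
          ‖(lineRestriction p fun j => (x j : ℂ)).eval (t : ℂ)‖ := by
        intro t ht
        have := hc (Fin.cons t x) (fun j => by
          refine Fin.cases ?_ (fun j => ?_) j
          · simpa using ht
          · simpa using hx j)
        rw [Fin.prod_univ_succ] at this
        simp only [Fin.cons_zero, Fin.cons_succ] at this
        rw [eval_lineRestriction]
        have e : (fun j => ((Fin.cons t x : Fin (k + 1) → ℝ) j : ℂ)) =
            (Fin.cons (t : ℂ) (fun j => (x j : ℂ)) : Fin (k + 1) → ℂ) := by
          funext j
          refine Fin.cases ?_ (fun j => ?_) j <;> simp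
        rw [e] at this
        linarith
      rw [hq, ← eval_derivative_lineRestriction_zero]
      by_cases h0 : (fun j => (x j : ℂ)) = 0
      · have hk : IsEmpty (Fin k) := ⟨fun j => (hx j).ne' (by simpa using congrFun h0 j)⟩
        obtain rfl : k = 0 := by
          by_contra h
          exact hk.elim ⟨0, Nat.pos_of_ne_zero h⟩
        have h1 := hR 1 one_pos
        have e := eval_lineRestriction_zero hp (fun j => (x j : ℂ))
        rw [← h0] at e
        rw [Complex.ofReal_one, e, coeff_lineRestriction,
          ← eval_derivative_lineRestriction_zero, mul_one] at h1
        refine le_trans ?_ h1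
        have : Real.exp (-1) ≤ 1 := Real.exp_le_one_iff.2 (by norm_num)
        simp only [Finset.univ_eq_empty, Finset.prod_empty, mul_one]
        exact mul_le_of_le_one_right hc0 this
      · have hx' : ∀ j, (x j : ℂ) = 0 ∨ 0 < (x j : ℂ).re := fun j => by simp [hx j]
        have := norm_derivative_ge_of_roots_neg (R := lineRestriction p fun j => (x j : ℂ))
          (fun h => by simpa using re_neg_of_mem_roots_lineRestriction hs hp hx' h0 h)
          (by
            rw [eval_derivative_lineRestriction_zero]
            exact hqs _ hx' h0)
          (fun ρ hρ =>
            ⟨real_of_mem_roots_lineRestriction hs hp hx h0 (Polynomial.isRoot_of_mem_roots hρ),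
            re_neg_of_mem_roots_lineRestriction hs hp hx' h0 (Polynomial.isRoot_of_mem_roots hρ)⟩)
          hR
        linarith
    refine le_trans (le_of_eq ?_) (hqs.capacity_le_coeff hqh (by positivity) hstep)
    rw [mul_assoc, ← Real.exp_add]
    push_cast
    ring_nf

/-- The polynomial `∏ᵢ ∑ⱼ Aᵢⱼ Xⱼ`, whose square-free coefficient is the permanent of `A`. -/
def rowProduct {n : ℕ} (A : Fin n → Fin n → ℝ) : MvPolynomial (Fin n) ℂ :=
  ∏ i, ∑ j, C (A i j : ℂ) * X j

theorem eval_rowProduct {n : ℕ} (A : Fin n → Fin n → ℝ) (z : Fin n → ℂ) :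
    eval z (rowProduct A) = ∏ i, ∑ j, (A i j : ℂ) * z j := by
  simp [rowProduct]

theorem isHomogeneous_rowProduct {n : ℕ} (A : Fin n → Fin n → ℝ) :
    (rowProduct A).IsHomogeneous n := by
  have := IsHomogeneous.prod Finset.univ (fun i => ∑ j, C (A i j : ℂ) * X j) (fun _ => 1)
    fun i _ => IsHomogeneous.sum _ _ _ fun j _ => isHomogeneous_C_mul_X _ _
  simpa [rowProduct] using this

theorem isStable_rowProduct {n : ℕ} {A : Fin n → Fin n → ℝ} (hA : ∀ i j, 0 < A i j) :
    IsStable (rowProduct A) := by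
  intro z hz h0
  rw [eval_rowProduct]
  refine Finset.prod_ne_zero_iff.2 fun i _ h => ?_
  obtain ⟨j, hj⟩ : ∃ j, z j ≠ 0 := by
    by_contra! h
    exact h0 (funext h)
  have hre : 0 < (∑ j, (A i j : ℂ) * z j).re := by
    rw [Complex.re_sum]
    simp only [Complex.re_ofReal_mul]
    refine Finset.sum_pos' (fun j _ => mul_nonneg (hA i j).le ?_)
      ⟨j, Finset.mem_univ j, mul_pos (hA i j) ((hz j).resolve_left hj)⟩
    rcases hz j with h | h
    · simp [h]
    · exact h.le
  simp [h] at hre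

theorem coeff_rowProduct {n : ℕ} (A : Fin n → Fin n → ℝ) :
    coeff (Finsupp.equivFunOnFinite.symm fun _ => 1) (rowProduct A) =
      ((∑ σ : Equiv.Perm (Fin n), ∏ i, A i (σ i) : ℝ) : ℂ) := by
  have hmon : ∀ f : Fin n → Fin n, ∏ i, (C (A i (f i) : ℂ) * X (f i) : MvPolynomial (Fin n) ℂ) =
      monomial (∑ i, Finsupp.single (f i) 1) (∏ i, (A i (f i) : ℂ)) := by
    intro f
    rw [monomial_sum_index]
    simp only [Finset.prod_mul_distrib, X, map_prod]
  have hbij : ∀ f : Fin n → Fin n, (∑ i, Finsupp.single (f i) 1 =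
      (Finsupp.equivFunOnFinite.symm fun _ => 1 : Fin n →₀ ℕ)) ↔ Function.Bijective f := by
    intro f
    have h1 : ∀ j, (∑ i, Finsupp.single (f i) 1 : Fin n →₀ ℕ) j =
        (Finset.univ.filter fun i => f i = j).card := by
      intro j
      rw [Finsupp.finsetSum_apply, Finset.card_filter]
      simp only [Finsupp.single_apply]
    constructor
    · intro h
      rw [← Finite.surjective_iff_bijective]
      intro j
      have h2 := h1 j
      rw [h] at h2
      obtain ⟨i, hi⟩ := Finset.card_pos.1 (by rw [← h2]; simp)
      exact ⟨i, (Finset.mem_filter.1 hi).2⟩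
    · intro h
      ext j
      rw [h1 j]
      obtain ⟨i, rfl⟩ := h.2 j
      simp only [h.1.eq_iff, Finset.filter_eq', Finset.mem_univ, if_true, Finset.card_singleton]
      rfl
  rw [rowProduct, Finset.prod_univ_sum, coeff_sum, Fintype.piFinset_univ]
  simp only [hmon, coeff_monomial, hbij]
  rw [← Finset.sum_filter]
  push_cast
  refine (Finset.sum_bij (fun (σ : Equiv.Perm (Fin n)) _ => (σ : Fin n → Fin n)) ?_ ?_ ?_ ?_).symm
  · intro σ _
    exact Finset.mem_filter.2 ⟨Finset.mem_univ _, σ.bijective⟩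
  · intro σ _ τ _ h
    exact Equiv.coe_fn_injective h
  · intro f hf
    exact ⟨Equiv.ofBijective f (Finset.mem_filter.1 hf).2, Finset.mem_univ _, rfl⟩
  · intro σ _
    rfl

theorem exp_neg_le_permanent_of_pos {n : ℕ} {A : Fin n → Fin n → ℝ} (hA : ∀ i j, 0 < A i j)
    (hrow : ∀ i, ∑ j, A i j = 1) (hcol : ∀ j, ∑ i, A i j = 1) :
    Real.exp (-n) ≤ ∑ σ : Equiv.Perm (Fin n), ∏ i, A i (σ i) := by
  have hcap : ∀ x : Fin n → ℝ, (∀ j, 0 < x j) →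
      1 * ∏ j, x j ≤ ‖eval (fun j => (x j : ℂ)) (rowProduct A)‖ := by
    intro x hx
    have h1 : ∀ i, ∏ j, x j ^ A i j ≤ ∑ j, A i j * x j := fun i =>
      Real.geom_mean_le_arith_mean_weighted _ _ _ (fun j _ => (hA i j).le) (hrow i)
        fun j _ => (hx j).le
    have h2 : ∏ i, ∏ j, x j ^ A i j = ∏ j, x j := by
      rw [Finset.prod_comm]
      refine Finset.prod_congr rfl fun j _ => ?_
      rw [← Real.rpow_sum_of_pos (hx j), hcol, Real.rpow_one]
    have h3 : eval (fun j => (x j : ℂ)) (rowProduct A) = ((∏ i, ∑ j, A i j * x j : ℝ) : ℂ) := by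
      rw [eval_rowProduct]; push_cast; rfl
    rw [h3, Complex.norm_real, one_mul, ← h2]
    exact (Finset.prod_le_prod (fun i _ => Finset.prod_nonneg fun j _ =>
      Real.rpow_nonneg (hx j).le _) fun i _ => h1 i).trans (le_abs_self _)
  have h := (isStable_rowProduct hA).capacity_le_coeff (isHomogeneous_rowProduct A) zero_le_one hcap
  rw [coeff_rowProduct, Complex.norm_real, one_mul, Real.norm_of_nonneg] at h
  · exact h
  · exact Finset.sum_nonneg fun σ _ => Finset.prod_nonneg fun i _ => (hA _ _).le

/-- The permanent of a doubly stochastic `n × n` matrix is at least `e⁻ⁿ`. -/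
theorem exp_neg_le_permanent {n : ℕ} {A : Fin n → Fin n → ℝ} (hA : ∀ i j, 0 ≤ A i j)
    (hrow : ∀ i, ∑ j, A i j = 1) (hcol : ∀ j, ∑ i, A i j = 1) :
    Real.exp (-n) ≤ ∑ σ : Equiv.Perm (Fin n), ∏ i, A i (σ i) := by
  have hlim : Filter.Tendsto
      (fun ε : ℝ => ∑ σ : Equiv.Perm (Fin n), ∏ i, ((1 - ε) * A i (σ i) + ε * (1 / n)))
      (nhdsWithin 0 (Set.Ioo 0 1))
      (nhds (∑ σ : Equiv.Perm (Fin n), ∏ i, ((1 - 0) * A i (σ i) + 0 * (1 / n)))) :=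
    (Continuous.tendsto (by fun_prop) 0).mono_left nhdsWithin_le_nhds
  simp only [sub_zero, one_mul, zero_mul, add_zero] at hlim
  have hne : (nhdsWithin (0 : ℝ) (Set.Ioo 0 1)).NeBot := left_nhdsWithin_Ioo_neBot one_pos
  refine ge_of_tendsto hlim ?_
  filter_upwards [self_mem_nhdsWithin] with ε hε
  rcases Nat.eq_zero_or_pos n with rfl | hn
  · simp
  have hn' : (0 : ℝ) < n := by exact_mod_cast hn
  have h1 : (1 - ε) + n * (ε * (n : ℝ)⁻¹) = 1 := by field_simp; ring
  refine exp_neg_le_permanent_of_pos (A := fun i j => (1 - ε) * A i j + ε * (1 / n))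
    (fun i j => ?_) (fun i => ?_) (fun j => ?_)
  · have := mul_nonneg (sub_nonneg.2 hε.2.le) (hA i j)
    have := mul_pos hε.1 (one_div_pos.2 hn')
    linarith
  · simp [Finset.sum_add_distrib, ← Finset.mul_sum, hrow, h1]
  · simp [Finset.sum_add_distrib, ← Finset.mul_sum, hcol, h1]

end Permanent

/-- The bijections `σ` with `A i (σ i)` for all `i`, as a finset. -/
def bijectionsIn {α β : Type} [Fintype α] [Fintype β] (A : α → β → Prop) : Finset (α ≃ β) :=
  Finset.univ.filter fun σ => ∀ i, A i (σ i)

/-- Every row and every column of the relation `A` has `d` entries. -/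
def IsRegularRel {n : ℕ} (A : Fin n → Fin n → Prop) (d : ℕ) : Prop :=
  (∀ i, (Finset.univ.filter fun j => A i j).card = d) ∧
  ∀ j, (Finset.univ.filter fun i => A i j).card = d

theorem IsRegularRel.card_bijectionsIn_ge {n d : ℕ} {A : Fin n → Fin n → Prop}
    (hA : IsRegularRel A d) (hd : 0 < d) :
    ((d : ℝ) * Real.exp (-1)) ^ n ≤ (bijectionsIn A).card := by
  have hd' : (0 : ℝ) < d := by exact_mod_cast hd
  have h := exp_neg_le_permanent (A := fun i j => if A i j then (d : ℝ)⁻¹ else 0)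
    (fun i j => by split_ifs <;> positivity)
    (fun i => by
      rw [← Finset.sum_filter, Finset.sum_const, hA.1, nsmul_eq_mul, mul_inv_cancel₀ hd'.ne'])
    (fun j => by
      rw [← Finset.sum_filter, Finset.sum_const, hA.2, nsmul_eq_mul, mul_inv_cancel₀ hd'.ne'])
  have hprod : ∀ σ : Equiv.Perm (Fin n), (∏ i, if A i (σ i) then (d : ℝ)⁻¹ else 0) =
      if ∀ i, A i (σ i) then ((d : ℝ)⁻¹) ^ n else 0 := by
    intro σ
    rw [Finset.prod_ite_zero]
    simp
  simp only [hprod] at h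
  rw [← Finset.sum_filter, Finset.sum_const, nsmul_eq_mul] at h
  rw [mul_pow, ← Real.exp_nat_mul, mul_neg_one]
  have hcard : (Finset.univ.filter fun σ : Equiv.Perm (Fin n) => ∀ i, A i (σ i)).card =
      (bijectionsIn A).card := by
    unfold bijectionsIn
    congr!
  rw [hcard] at h
  calc (d : ℝ) ^ n * Real.exp (-n) ≤ d ^ n * ((bijectionsIn A).card * ((d : ℝ)⁻¹) ^ n) :=
        mul_le_mul_of_nonneg_left h (by positivity)
    _ = (bijectionsIn A).card := by
        rw [inv_pow]; field_simp

theorem mem_bijectionsIn {α β : Type} [Fintype α] [Fintype β] {A : α → β → Prop} {σ : α ≃ β} :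
    σ ∈ bijectionsIn A ↔ ∀ i, A i (σ i) := by
  simp [bijectionsIn]

/-- The logarithm of `(r!) ^ (1 / r)`. -/
def logFactorialMean (r : ℕ) : ℝ := Real.log r.factorial / r

theorem mul_logFactorialMean (r : ℕ) : r * logFactorialMean r = Real.log r.factorial := by
  rcases Nat.eq_zero_or_pos r with rfl | h
  · simp
  · have : (r : ℝ) ≠ 0 := by positivity
    rw [logFactorialMean]
    field_simp

/-- The number of columns related to the row `i`. -/
def rowDegree {α β : Type} [Fintype β] (A : α → β → Prop) (i : α) : ℕ :=
  (Finset.univ.filter fun j => A i j).card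

theorem rowDegree_pos {α β : Type} [Fintype α] [Fintype β] {A : α → β → Prop} {σ : α ≃ β}
    (hσ : σ ∈ bijectionsIn A) (i : α) : 0 < rowDegree A i :=
  Finset.card_pos.2 ⟨σ i, by simpa using mem_bijectionsIn.1 hσ i⟩

/-- The relation obtained by deleting the row `i` and the column `k`. -/
def minorRel {α β : Type} (A : α → β → Prop) (i : α) (k : β) :
    {a // a ≠ i} → {b // b ≠ k} → Prop :=
  fun a b => A a b

theorem rowDegree_minorRel {α β : Type} [Fintype β] (A : α → β → Prop) (i : α) (k : β)
    (a : {a // a ≠ i}) :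
    rowDegree (minorRel A i k) a = if A a k then rowDegree A a - 1 else rowDegree A a := by
  have h : rowDegree (minorRel A i k) a = ((Finset.univ.filter fun j => A a j).erase k).card := by
    unfold rowDegree minorRel
    rw [← Finset.card_map (Function.Embedding.subtype _)]
    congr 1
    ext b
    simp [and_comm]
  rw [h]
  split_ifs with hk
  · rw [Finset.card_erase_of_mem (by simpa using hk)]; rfl
  · rw [Finset.erase_eq_of_notMem (by simpa using hk)]; rfl

theorem card_filter_le_card_minorRel {α β : Type} [Fintype α] [Fintype β] (A : α → β → Prop)
    (i : α) (k : β) :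
    ((bijectionsIn A).filter fun σ => σ i = k).card ≤ (bijectionsIn (minorRel A i k)).card := by
  have hmin : ∀ σ : α ≃ β, σ i = k → ∀ a, a ≠ i ↔ σ a ≠ k := by
    rintro σ rfl a
    simp
  refine Finset.card_le_card_of_injOn
    (fun σ => if h : σ i = k then σ.subtypeEquiv (hmin σ h) else
      if h' : Nonempty ({a // a ≠ i} ≃ {b // b ≠ k}) then h'.some else
        (h' ⟨(Fintype.equivOfCardEq (by simp [Fintype.card_congr σ]))⟩).elim) ?_ ?_
  · intro σ hσ
    obtain ⟨h1, h2⟩ := Finset.mem_filter.1 hσ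
    simp only [h2, dif_pos]
    refine mem_bijectionsIn.2 fun a => ?_
    exact mem_bijectionsIn.1 h1 a
  · intro σ hσ τ hτ h
    have h1 := (Finset.mem_filter.1 hσ).2
    have h2 := (Finset.mem_filter.1 hτ).2
    simp only [h1, h2, dif_pos] at h
    ext a
    by_cases ha : a = i
    · rw [ha, h1, h2]
    · simpa using congrArg Subtype.val (DFunLike.congr_fun h ⟨a, ha⟩)

theorem card_mul_log_card_le {α β : Type} [Fintype α] [Fintype β] (A : α → β → Prop) (i : α) :
    (bijectionsIn A).card * Real.log (bijectionsIn A).card ≤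
      (bijectionsIn A).card * Real.log (rowDegree A i) + ∑ σ ∈ bijectionsIn A,
        Real.log ((bijectionsIn A).filter fun τ => τ i = σ i).card := by
  set T := bijectionsIn A with hT
  set x : β → ℕ := fun k => (T.filter fun τ => τ i = k).card with hx
  have hxpos : ∀ σ ∈ T, 0 < x (σ i) := fun σ hσ =>
    Finset.card_pos.2 ⟨σ, Finset.mem_filter.2 ⟨hσ, rfl⟩⟩
  have hinv : ∑ σ ∈ T, (x (σ i) : ℝ)⁻¹ ≤ rowDegree A i := by
    rw [← Finset.sum_fiberwise_of_maps_to (t := Finset.univ.filter fun k => A i k)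
      (g := fun σ : α ≃ β => σ i) fun σ hσ => by simpa using mem_bijectionsIn.1 hσ i]
    calc _ ≤ ∑ k ∈ Finset.univ.filter fun k => A i k, (1 : ℝ) := by
          refine Finset.sum_le_sum fun k _ => ?_
          rw [Finset.sum_congr rfl fun σ hσ => by rw [(Finset.mem_filter.1 hσ).2],
            Finset.sum_const, nsmul_eq_mul]
          exact mul_inv_le_one
      _ = _ := by simp [rowDegree]
  rcases T.eq_empty_or_nonempty with h0 | ⟨σ₀, hσ₀⟩
  · simp [h0]
  have hr : (0 : ℝ) < rowDegree A i := by exact_mod_cast rowDegree_pos hσ₀ i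
  have hP : (0 : ℝ) < T.card := by exact_mod_cast Finset.card_pos.2 ⟨σ₀, hσ₀⟩
  have hterm : ∀ σ ∈ T, Real.log T.card - Real.log (rowDegree A i) - Real.log (x (σ i)) ≤
      T.card / rowDegree A i * (x (σ i) : ℝ)⁻¹ - 1 := by
    intro σ hσ
    have hxσ : (0 : ℝ) < x (σ i) := by exact_mod_cast hxpos σ hσ
    rw [← Real.log_div hP.ne' hr.ne', ← Real.log_div (by positivity) hxσ.ne', ← div_eq_mul_inv]
    exact Real.log_le_sub_one_of_pos (by positivity)
  have hsum := Finset.sum_le_sum hterm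
  simp only [Finset.sum_sub_distrib, Finset.sum_const, nsmul_eq_mul, ← Finset.mul_sum] at hsum
  have : (T.card : ℝ) / rowDegree A i * ∑ σ ∈ T, (x (σ i) : ℝ)⁻¹ ≤ T.card :=
    calc _ ≤ (T.card : ℝ) / rowDegree A i * rowDegree A i := by gcongr
      _ = _ := by field_simp
  linarith

theorem sum_logFactorialMean_minorRel {α β : Type} [Fintype α] [Fintype β] {A : α → β → Prop}
    {σ : α ≃ β} (hσ : σ ∈ bijectionsIn A) :
    ∑ i, ∑ a, logFactorialMean (rowDegree (minorRel A i (σ i)) a) =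
      ∑ a, (Fintype.card α * logFactorialMean (rowDegree A a) - Real.log (rowDegree A a)) := by
  set f : α → β → ℝ := fun a k =>
    logFactorialMean (if A a k then rowDegree A a - 1 else rowDegree A a) with hf
  have h1 : ∀ i, ∑ a, logFactorialMean (rowDegree (minorRel A i (σ i)) a) =
      ∑ a, f a (σ i) - f i (σ i) := by
    intro i
    simp only [rowDegree_minorRel]
    have : ∑ a : {a // a ≠ i}, f a (σ i) = ∑ a ∈ Finset.univ.erase i, f a (σ i) :=
      (Finset.sum_subtype (Finset.univ.erase i) (by simp) fun a => f a (σ i)).symm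
    rw [eq_sub_iff_add_eq, this, Finset.sum_erase_add _ _ (Finset.mem_univ i)]
  simp only [h1]
  rw [Finset.sum_sub_distrib, Finset.sum_comm, ← Finset.sum_sub_distrib]
  refine Finset.sum_congr rfl fun a _ => ?_
  have hpos := rowDegree_pos hσ a
  have h2 : ∑ i, f a (σ i) = ∑ k, f a k := Equiv.sum_comp σ (f a)
  have h3 : ∑ k, f a k = rowDegree A a * logFactorialMean (rowDegree A a - 1) +
      (Fintype.card α - rowDegree A a) * logFactorialMean (rowDegree A a) := by
    have h4 : ∀ k, f a k = logFactorialMean (rowDegree A a) + if A a k then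
        logFactorialMean (rowDegree A a - 1) - logFactorialMean (rowDegree A a) else 0 := by
      intro k
      simp only [hf]
      split_ifs <;> ring
    simp only [h4, Finset.sum_add_distrib, ← Finset.sum_filter, Finset.sum_const, nsmul_eq_mul,
      Finset.card_univ, ← Fintype.card_congr σ]
    rw [show (Finset.univ.filter fun k => A a k).card = rowDegree A a from rfl]
    ring
  have h5 : f a (σ a) = logFactorialMean (rowDegree A a - 1) := by
    simp only [hf, if_pos (mem_bijectionsIn.1 hσ a)]
  rw [h2, h3, h5]
  obtain ⟨r, hr⟩ : ∃ r, rowDegree A a = r + 1 := ⟨_, (Nat.succ_pred_eq_of_pos hpos).symm⟩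
  rw [hr, Nat.add_sub_cancel]
  have e1 := mul_logFactorialMean r
  have e2 := mul_logFactorialMean (r + 1)
  rw [Nat.factorial_succ, Nat.cast_mul, Real.log_mul (by positivity) (by positivity)] at e2
  push_cast at e2 ⊢
  linarith

/-- Brègman's theorem: the permanent of a zero-one matrix with row sums `rᵢ` is at most
`∏ᵢ (rᵢ!) ^ (1 / rᵢ)`. -/
theorem log_card_bijectionsIn_le : ∀ (n : ℕ) {α β : Type} [Fintype α] [Fintype β]
    (A : α → β → Prop), Fintype.card α = n → (bijectionsIn A).Nonempty →
    Real.log (bijectionsIn A).card ≤ ∑ i, logFactorialMean (rowDegree A i)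
  | 0, α, β, _, _, A, hn, hA => by
    have hα : IsEmpty α := Fintype.card_eq_zero_iff.1 hn
    have : (bijectionsIn A).card ≤ 1 := Finset.card_le_one.2 fun σ _ τ _ =>
      Equiv.ext fun a => hα.elim a
    have h1 : ((bijectionsIn A).card : ℝ) ≤ 1 := by exact_mod_cast this
    simpa using Real.log_nonpos (by positivity) h1
  | n + 1, α, β, _, _, A, hn, hA => by
    set T := bijectionsIn A with hT
    have hP : (0 : ℝ) < T.card := by exact_mod_cast Finset.card_pos.2 hA
    have hIH : ∀ σ ∈ T, ∀ i, Real.log (T.filter fun τ => τ i = σ i).card ≤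
        ∑ a, logFactorialMean (rowDegree (minorRel A i (σ i)) a) := by
      intro σ hσ i
      have hpos : 0 < (T.filter fun τ => τ i = σ i).card :=
        Finset.card_pos.2 ⟨σ, Finset.mem_filter.2 ⟨hσ, rfl⟩⟩
      have hle := card_filter_le_card_minorRel A i (σ i)
      refine le_trans (Real.log_le_log (by exact_mod_cast hpos) (Nat.cast_le.2 hle)) ?_
      exact log_card_bijectionsIn_le n (minorRel A i (σ i)) (by simp [hn])
        (Finset.card_pos.1 (hpos.trans_le hle))
    have h1 : ∑ i : α, (T.card * Real.log T.card) ≤ ∑ i, (T.card * Real.log (rowDegree A i)) +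
        ∑ σ ∈ T, ∑ a, (Fintype.card α * logFactorialMean (rowDegree A a) -
          Real.log (rowDegree A a)) := by
      refine (Finset.sum_le_sum fun i _ => card_mul_log_card_le A i).trans ?_
      rw [Finset.sum_add_distrib, Finset.sum_comm]
      refine add_le_add le_rfl (Finset.sum_le_sum fun σ hσ => ?_)
      rw [← sum_logFactorialMean_minorRel hσ]
      exact Finset.sum_le_sum fun i _ => hIH σ hσ i
    simp only [Finset.sum_const, nsmul_eq_mul, Finset.card_univ, hn, ← Finset.mul_sum,
      Finset.sum_sub_distrib] at h1
    have h2 : ((n + 1 : ℕ) : ℝ) * T.card * Real.log T.card ≤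
        ((n + 1 : ℕ) : ℝ) * T.card * ∑ i, logFactorialMean (rowDegree A i) := by linarith
    exact le_of_mul_le_mul_left h2 (by positivity)

theorem log_factorial_le {d : ℕ} (hd : 0 < d) :
    Real.log d.factorial ≤ d * Real.log d - d + Real.log d + 1 := by
  induction d, hd using Nat.le_induction with
  | base => simp
  | succ d hd ih =>
    have hd' : (0 : ℝ) < d := by exact_mod_cast hd
    rw [Nat.factorial_succ, Nat.cast_mul, Real.log_mul (by positivity) (by positivity)]
    have h : 1 ≤ (d + 1) * (Real.log (d + 1 : ℝ) - Real.log d) := by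
      have h1 := Real.one_sub_inv_le_log_of_pos (x := ((d : ℝ) + 1) / d) (by positivity)
      rw [Real.log_div (by positivity) hd'.ne'] at h1
      have h2 := mul_le_mul_of_nonneg_left h1 (by positivity : (0 : ℝ) ≤ d + 1)
      calc (1 : ℝ) = (d + 1) * (1 - (((d : ℝ) + 1) / d)⁻¹) := by field_simp; ring
        _ ≤ _ := h2
    push_cast
    linarith

theorem IsRegularRel.card_bijectionsIn_le {n d : ℕ} {A : Fin n → Fin n → Prop}
    (hA : IsRegularRel A d) (hd : 0 < d) :
    ((bijectionsIn A).card : ℝ) ≤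
      ((d : ℝ) * Real.exp (-1)) ^ n * Real.exp (n * ((Real.log d + 1) / d)) := by
  have hd' : (0 : ℝ) < d := by exact_mod_cast hd
  rcases (bijectionsIn A).eq_empty_or_nonempty with h0 | hne
  · rw [h0]; simp; positivity
  have hP : (0 : ℝ) < (bijectionsIn A).card := by exact_mod_cast Finset.card_pos.2 hne
  have h := log_card_bijectionsIn_le n A (by simp) hne
  have hrow : ∀ i, rowDegree A i = d := hA.1
  simp only [hrow, Finset.sum_const, Finset.card_univ, Fintype.card_fin, nsmul_eq_mul] at h
  have h1 : logFactorialMean d ≤ Real.log d - 1 + (Real.log d + 1) / d := by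
    rw [logFactorialMean, div_le_iff₀ hd']
    refine (log_factorial_le hd).trans (le_of_eq ?_)
    field_simp
    ring
  rw [← Real.log_le_log_iff hP (by positivity), Real.log_mul (by positivity) (by positivity),
    Real.log_exp, Real.log_pow, Real.log_mul hd'.ne' (by positivity), Real.log_exp]
  have := mul_le_mul_of_nonneg_left h1 (Nat.cast_nonneg (α := ℝ) n)
  linarith

/-- The families of `m` pairwise disjoint permutations contained in the relation `A`. -/
abbrev DisjointPerms {n : ℕ} (m : ℕ) (A : Fin n → Fin n → Prop) : Type :=
  {g : Fin m → Equiv.Perm (Fin n) // (∀ i, Function.Injective fun d => g d i) ∧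
    ∀ d i, A i (g d i)}

/-- The relation `A` with the graph of `σ` removed. -/
def removeGraph {n : ℕ} (A : Fin n → Fin n → Prop) (σ : Equiv.Perm (Fin n)) :
    Fin n → Fin n → Prop :=
  fun i j => A i j ∧ j ≠ σ i

theorem IsRegularRel.removeGraph {n d : ℕ} {A : Fin n → Fin n → Prop}
    (hA : IsRegularRel A (d + 1)) {σ : Equiv.Perm (Fin n)} (hσ : σ ∈ bijectionsIn A) :
    IsRegularRel (removeGraph A σ) d := by
  rw [mem_bijectionsIn] at hσ
  constructor
  · intro i
    have : (Finset.univ.filter fun j => RandomLatin.removeGraph A σ i j) =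
        (Finset.univ.filter fun j => A i j).erase (σ i) := by
      ext j
      rw [Finset.mem_filter, Finset.mem_erase, Finset.mem_filter]
      exact ⟨fun h => ⟨h.2.2, h.1, h.2.1⟩, fun h => ⟨h.2.1, h.2.2, h.1⟩⟩
    rw [this, Finset.card_erase_of_mem (by simpa using hσ i), hA.1, Nat.add_sub_cancel]
  · intro j
    have : (Finset.univ.filter fun i => RandomLatin.removeGraph A σ i j) =
        (Finset.univ.filter fun i => A i j).erase (σ.symm j) := by
      ext i
      rw [Finset.mem_filter, Finset.mem_erase, Finset.mem_filter, Ne, Equiv.eq_symm_apply,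
        eq_comm]
      exact ⟨fun h => ⟨h.2.2, h.1, h.2.1⟩, fun h => ⟨h.2.1, h.2.2, h.1⟩⟩
    rw [this, Finset.card_erase_of_mem (by simpa using hσ (σ.symm j)), hA.2, Nat.add_sub_cancel]

/-- Splitting off the first permutation of a family. -/
def disjointPermsSuccEquiv {n : ℕ} (m : ℕ) (A : Fin n → Fin n → Prop) :
    DisjointPerms (m + 1) A ≃
      Σ σ : {σ // σ ∈ bijectionsIn A}, DisjointPerms m (removeGraph A σ.1) where
  toFun g := ⟨⟨g.1 0, mem_bijectionsIn.2 (g.2.2 0)⟩, fun d => g.1 d.succ,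
    fun i _ _ h => Fin.succ_injective _ (g.2.1 i h),
    fun d i => ⟨g.2.2 _ i, fun h => Fin.succ_ne_zero d (g.2.1 i h)⟩⟩
  invFun s := ⟨Fin.cons s.1.1 s.2.1, by
    refine ⟨fun i d d' => ?_, fun d i => ?_⟩
    · refine Fin.cases ?_ (fun d => ?_) d <;> refine Fin.cases ?_ (fun d' => ?_) d'
      · simp
      · intro h
        exact absurd h.symm (s.2.2.2 d' i).2
      · intro h
        exact absurd h (s.2.2.2 d i).2
      · intro h
        exact congrArg Fin.succ (s.2.2.1 i h)
    · refine Fin.cases ?_ (fun d => ?_) d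
      · exact mem_bijectionsIn.1 s.1.2 i
      · exact (s.2.2.2 d i).1⟩
  left_inv g := by
    ext1
    exact Fin.cons_self_tail g.1
  right_inv s := rfl

theorem card_disjointPerms_succ {n : ℕ} (m : ℕ) (A : Fin n → Fin n → Prop) :
    Nat.card (DisjointPerms (m + 1) A) =
      ∑ σ ∈ bijectionsIn A, Nat.card (DisjointPerms m (removeGraph A σ)) := by
  rw [Nat.card_congr (disjointPermsSuccEquiv m A), Nat.card_sigma]
  exact Finset.sum_coe_sort (bijectionsIn A)
    fun σ => Nat.card (DisjointPerms m (removeGraph A σ))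

theorem card_disjointPerms_zero {n : ℕ} (A : Fin n → Fin n → Prop) :
    Nat.card (DisjointPerms 0 A) = 1 := by
  have : Unique (DisjointPerms 0 A) :=
    { default := ⟨Fin.elim0, fun _ d => d.elim0, fun d => d.elim0⟩
      uniq := fun _ => Subsingleton.elim _ _ }
  exact Nat.card_unique

theorem IsRegularRel.card_disjointPerms_ge {n m : ℕ} {A : Fin n → Fin n → Prop}
    (hA : IsRegularRel A m) :
    ∏ d ∈ Finset.range m, (((d + 1 : ℕ) : ℝ) * Real.exp (-1)) ^ n ≤
      Nat.card (DisjointPerms m A) := by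
  induction m generalizing A with
  | zero =>
    rw [card_disjointPerms_zero]
    simp
  | succ m ih =>
    rw [card_disjointPerms_succ, Finset.prod_range_succ, mul_comm, Nat.cast_sum]
    calc _ ≤ ((bijectionsIn A).card : ℝ) *
          ∏ d ∈ Finset.range m, (((d + 1 : ℕ) : ℝ) * Real.exp (-1)) ^ n :=
          mul_le_mul_of_nonneg_right (hA.card_bijectionsIn_ge m.succ_pos) (by positivity)
      _ = ∑ σ ∈ bijectionsIn A,
          ∏ d ∈ Finset.range m, (((d + 1 : ℕ) : ℝ) * Real.exp (-1)) ^ n := by simp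
      _ ≤ _ := Finset.sum_le_sum fun σ hσ => ih (hA.removeGraph hσ)

theorem IsRegularRel.card_disjointPerms_le {n m : ℕ} {A : Fin n → Fin n → Prop}
    (hA : IsRegularRel A m) :
    (Nat.card (DisjointPerms m A) : ℝ) ≤
      (∏ d ∈ Finset.range m, (((d + 1 : ℕ) : ℝ) * Real.exp (-1)) ^ n) *
        Real.exp (n * ∑ d ∈ Finset.range m,
          (Real.log ((d + 1 : ℕ) : ℝ) + 1) / ((d + 1 : ℕ) : ℝ)) := by
  induction m generalizing A with
  | zero =>
    rw [card_disjointPerms_zero]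
    simp
  | succ m ih =>
    rw [card_disjointPerms_succ, Finset.prod_range_succ, Finset.sum_range_succ, Nat.cast_sum,
      mul_add, Real.exp_add]
    set P := ∏ d ∈ Finset.range m, (((d + 1 : ℕ) : ℝ) * Real.exp (-1)) ^ n with hP
    set E := Real.exp (n * ∑ d ∈ Finset.range m,
      (Real.log ((d + 1 : ℕ) : ℝ) + 1) / ((d + 1 : ℕ) : ℝ)) with hE
    calc _ ≤ ∑ σ ∈ bijectionsIn A, P * E :=
          Finset.sum_le_sum fun σ hσ => ih (hA.removeGraph hσ)
      _ = ((bijectionsIn A).card : ℝ) * (P * E) := by simp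
      _ ≤ _ := mul_le_mul_of_nonneg_right (hA.card_bijectionsIn_le m.succ_pos) (by positivity)
      _ = _ := by ring

/-- The arcs not used by `H`. -/
def unusedArcs {n : ℕ} {D : Finset (Fin n)} (H : GD n D) : Fin n → Fin n → Prop :=
  fun i j => ∀ d, H.1 d i ≠ j

theorem isRegularRel_unusedArcs {n : ℕ} {D : Finset (Fin n)} (H : GD n D) :
    IsRegularRel (unusedArcs H) Dᶜ.card := by
  have key : ∀ f : {d // d ∈ D} → Fin n, Function.Injective f →
      (Finset.univ.image f)ᶜ.card = Dᶜ.card := by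
    intro f hf
    rw [Finset.card_compl, Finset.card_compl, Finset.card_image_of_injective _ hf,
      Finset.card_univ, Fintype.card_coe]
  constructor
  · intro i
    rw [← key (fun d => H.1 d i) (H.2.2 i)]
    congr 1
    ext j
    simp [unusedArcs]
  · intro j
    let e : {d // d ∈ D} → Equiv.Perm (Fin n) := fun d => Equiv.ofBijective _ (H.2.1 d)
    have he : ∀ d i, e d i = H.1 d i := fun _ _ => rfl
    rw [← key (fun d => (e d).symm j) ?_]
    · congr 1
      ext i
      rw [Finset.mem_filter]
      simp only [Finset.mem_compl, Finset.mem_image, Finset.mem_univ, true_and, not_exists]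
      refine forall_congr' fun d => not_congr ?_
      rw [Equiv.symm_apply_eq, he, eq_comm]
    · intro d d' h
      refine H.2.2 ((e d).symm j) ?_
      change e d ((e d).symm j) = e d' ((e d).symm j)
      have h : (e d).symm j = (e d').symm j := h
      rw [Equiv.apply_symm_apply, h, Equiv.apply_symm_apply]

theorem completionCount_eq {n : ℕ} {D : Finset (Fin n)} (H : GD n D) :
    completionCount H = Nat.card (DisjointPerms Dᶜ.card (unusedArcs H)) := by
  let e : {d // d ∈ Dᶜ} ≃ Fin Dᶜ.card := Dᶜ.equivFin
  refine Nat.card_congr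
    { toFun := fun g => ⟨fun d => Equiv.ofBijective _ (g.1.2.1 (e.symm d)),
        fun i d d' h => e.symm.injective (g.1.2.2 i h), fun d i d' => g.2 d' (e.symm d) i⟩
      invFun := fun g => ⟨⟨fun d => g.1 (e d), fun d => (g.1 (e d)).bijective,
        fun i d d' h => e.injective (g.2.1 i h)⟩, fun d d' i => g.2.2 (e d') i d⟩
      left_inv := fun g => ?_
      right_inv := fun g => ?_ }
  · refine Subtype.ext (Subtype.ext (funext fun d => ?_))
    simp
  · refine Subtype.ext (funext fun d => Equiv.ext fun i => ?_)
    simp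

theorem sum_log_add_one_div_le {m n : ℕ} (hn : 2 ≤ n) (hm : m ≤ n) :
    ∑ d ∈ Finset.range m, (Real.log ((d + 1 : ℕ) : ℝ) + 1) / ((d + 1 : ℕ) : ℝ) ≤
      9 * Real.log n ^ 2 := by
  have hlog : 1 ≤ 2 * Real.log n := by
    have h2 : Real.log 2 ≤ Real.log n := Real.log_le_log two_pos (by exact_mod_cast hn)
    have := Real.log_two_gt_d9
    linarith
  have hharm : ∑ d ∈ Finset.range n, (((d + 1 : ℕ) : ℝ))⁻¹ ≤ 1 + Real.log n := by
    have := harmonic_le_one_add_log n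
    simpa [harmonic] using this
  calc _ ≤ ∑ d ∈ Finset.range m, (Real.log n + 1) * (((d + 1 : ℕ) : ℝ))⁻¹ := by
        refine Finset.sum_le_sum fun d hd => ?_
        rw [div_eq_mul_inv]
        have : d + 1 ≤ n := (Finset.mem_range.1 hd).trans_le hm
        gcongr
    _ ≤ ∑ d ∈ Finset.range n, (Real.log n + 1) * (((d + 1 : ℕ) : ℝ))⁻¹ :=
        Finset.sum_le_sum_of_subset_of_nonneg (Finset.range_mono hm) fun d _ _ =>
          mul_nonneg (by linarith) (by positivity)
    _ = (Real.log n + 1) * ∑ d ∈ Finset.range n, (((d + 1 : ℕ) : ℝ))⁻¹ := by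
        rw [Finset.mul_sum]
    _ ≤ (Real.log n + 1) * (1 + Real.log n) := by gcongr
    _ ≤ 9 * Real.log n ^ 2 := by nlinarith

/-- There is `C > 0` such that for every `n ≥ 2`, every `D ⊆ [n]` and
all `H, H' ∈ 𝒢_D`, `comp(H) ≤ exp(C n (log n)²) comp(H')`. -/
theorem statement_5 :
    ∃ C : ℝ, 0 < C ∧ ∀ n : ℕ, 2 ≤ n → ∀ D : Finset (Fin n), ∀ H H' : GD n D,
      (completionCount H : ℝ) ≤
        Real.exp (C * n * Real.log n ^ 2) * completionCount H' := by
  refine ⟨9, by norm_num, fun n hn D H H' => ?_⟩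
  rw [completionCount_eq, completionCount_eq, mul_comm]
  refine (isRegularRel_unusedArcs H).card_disjointPerms_le.trans ?_
  refine mul_le_mul (isRegularRel_unusedArcs H').card_disjointPerms_ge ?_
    (Real.exp_pos _).le (Nat.cast_nonneg _)
  have hm : Dᶜ.card ≤ n := by simpa using Dᶜ.card_le_univ
  have := mul_le_mul_of_nonneg_left (sum_log_add_one_div_le hn hm) (Nat.cast_nonneg (α := ℝ) n)
  exact Real.exp_le_exp.2 (by linarith)

end RandomLatin
end
end

section
/- There exist constants a > 0 and n₀ such that the following holds for all n ≥ n₀ divisible by 10⁶. Let D ⊆ [n] with |D| = n/10⁶, fix c ∈ D, let H be chosen uniformly at random from 𝒢_D, and let F_c(H) denote the set of arcs of H with colour c. Then for every possible outcome F of F_c(H) (i.e., every arc set F with P[F_c(H) = F] > 0), the conditional probability, given F_c(H) = F, that e_H(A₁,A₂) ≤ 2|D|³/n for all (not necessarily distinct) vertex sets A₁, A₂ ⊆ [n] of size |A₁| = |A₂| = |D|, is at least 1 − exp(−a·n²). -/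
open scoped Classical

noncomputable section

namespace RandomLatin

/-! ### Switchings -/

instance {n : ℕ} (D : Finset (Fin n)) : Finite (GD n D) := by
  unfold GD
  infer_instance

instance {n : ℕ} (D : Finset (Fin n)) : Fintype (GD n D) := Fintype.ofFinite _

/-- The element of `𝒢_D` obtained from `H` by exchanging the heads of the two `d`-coloured
arcs with tails `a` and `x`, when this creates no repeated arc. -/
def switch {n : ℕ} {D : Finset (Fin n)} (H : GD n D) (d : {d : Fin n // d ∈ D}) (a x : Fin n)
    (ha : ∀ d', H.1 d' a ≠ H.1 d x) (hx : ∀ d', H.1 d' x ≠ H.1 d a) : GD n D :=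
  ⟨Function.update H.1 d (H.1 d ∘ Equiv.swap a x), by
    have key : ∀ (i : Fin n) (d' : {d : Fin n // d ∈ D}), d' ≠ d →
        H.1 d (Equiv.swap a x i) ≠ H.1 d' i := by
      intro i d' hd'
      by_cases hia : i = a
      · subst hia
        rw [Equiv.swap_apply_left]
        exact (ha d').symm
      by_cases hix : i = x
      · subst hix
        rw [Equiv.swap_apply_right]
        exact (hx d').symm
      rw [Equiv.swap_apply_of_ne_of_ne hia hix]
      exact fun h => hd' (H.2.2 i h).symm
    refine ⟨fun d' => ?_, fun i d₁ d₂ h => ?_⟩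
    · by_cases hd : d' = d
      · subst hd
        rw [Function.update_self]
        exact (H.2.1 _).comp (Equiv.bijective _)
      · rw [Function.update_of_ne hd]
        exact H.2.1 d'
    · by_cases h₁ : d₁ = d <;> by_cases h₂ : d₂ = d
      · rw [h₁, h₂]
      · subst h₁
        simp only [Function.update_self, Function.update_of_ne h₂, Function.comp_apply] at h
        exact absurd h (key i d₂ h₂)
      · subst h₂
        simp only [Function.update_self, Function.update_of_ne h₁, Function.comp_apply] at h
        exact absurd h.symm (key i d₁ h₁)
      · simp only [Function.update_of_ne h₁, Function.update_of_ne h₂] at h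
        exact H.2.2 i h⟩

/-- The arcs of `H` from `A` to `B` of colour other than `c`, recorded by colour and tail. -/
def arcsAvoiding {n : ℕ} {D : Finset (Fin n)} (c : {d : Fin n // d ∈ D}) (A B : Finset (Fin n))
    (H : GD n D) : Finset ({d : Fin n // d ∈ D} × Fin n) :=
  Finset.univ.filter fun p => p.1 ≠ c ∧ p.2 ∈ A ∧ H.1 p.1 p.2 ∈ B

/-- The tails `x` that cannot be switched with `a` in colour `d`, and those lying in `A`. -/
def blockedTails {n : ℕ} {D : Finset (Fin n)} (A : Finset (Fin n)) (H : GD n D)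
    (p : {d : Fin n // d ∈ D} × Fin n) : Finset (Fin n) :=
  A ∪ ((Finset.univ.filter fun x => ∃ d', H.1 d' p.2 = H.1 p.1 x) ∪
    Finset.univ.filter fun x => ∃ d', H.1 d' x = H.1 p.1 p.2)

lemma card_blockedTails_le {n : ℕ} {D A : Finset (Fin n)} (hA : A.card = D.card) (H : GD n D)
    (p : {d : Fin n // d ∈ D} × Fin n) : (blockedTails A H p).card ≤ 3 * D.card := by
  have hD : Fintype.card {d : Fin n // d ∈ D} = D.card := by simp
  have h₁ : (Finset.univ.filter fun x => ∃ d', H.1 d' p.2 = H.1 p.1 x).card ≤ D.card := by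
    rw [← hD, ← Finset.card_univ]
    refine le_trans (Finset.card_le_card (t := Finset.univ.image fun d' =>
      (Equiv.ofBijective _ (H.2.1 p.1)).symm (H.1 d' p.2)) ?_) Finset.card_image_le
    intro x hx
    obtain ⟨d', hd'⟩ := (Finset.mem_filter.1 hx).2
    refine Finset.mem_image.2 ⟨d', Finset.mem_univ _, ?_⟩
    rw [Equiv.symm_apply_eq, Equiv.ofBijective_apply, hd']
  have h₂ : (Finset.univ.filter fun x => ∃ d', H.1 d' x = H.1 p.1 p.2).card ≤ D.card := by
    rw [← hD, ← Finset.card_univ]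
    refine le_trans (Finset.card_le_card (t := Finset.univ.image fun d' =>
      (Equiv.ofBijective _ (H.2.1 d')).symm (H.1 p.1 p.2)) ?_) Finset.card_image_le
    intro x hx
    obtain ⟨d', hd'⟩ := (Finset.mem_filter.1 hx).2
    refine Finset.mem_image.2 ⟨d', Finset.mem_univ _, ?_⟩
    rw [Equiv.symm_apply_eq, Equiv.ofBijective_apply, hd']
  have h₃ := Finset.card_union_le A
    ((Finset.univ.filter fun x => ∃ d', H.1 d' p.2 = H.1 p.1 x) ∪
      Finset.univ.filter fun x => ∃ d', H.1 d' x = H.1 p.1 p.2)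
  have h₄ := Finset.card_union_le (Finset.univ.filter fun x => ∃ d', H.1 d' p.2 = H.1 p.1 x)
    (Finset.univ.filter fun x => ∃ d', H.1 d' x = H.1 p.1 p.2)
  unfold blockedTails
  omega

lemma card_arcsAvoiding_switch {n : ℕ} {D A B : Finset (Fin n)} {c : {d : Fin n // d ∈ D}}
    (H : GD n D) {d : {d : Fin n // d ∈ D}} {a x : Fin n} (hxA : x ∉ A)
    (ha : ∀ d', H.1 d' a ≠ H.1 d x) (hx : ∀ d', H.1 d' x ≠ H.1 d a) :
    (arcsAvoiding c A B H).card ≤ (arcsAvoiding c A B (switch H d a x ha hx)).card + 1 := by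
  have hsub : (arcsAvoiding c A B H).erase (d, a) ⊆
      arcsAvoiding c A B (switch H d a x ha hx) := by
    rintro ⟨d', i⟩ hp
    rw [Finset.mem_erase] at hp
    obtain ⟨hne, hp⟩ := hp
    simp only [arcsAvoiding, Finset.mem_filter, Finset.mem_univ, true_and] at hp ⊢
    refine ⟨hp.1, hp.2.1, ?_⟩
    by_cases hd : d' = d
    · subst hd
      have hia : i ≠ a := fun h => hne (by rw [h])
      have hix : i ≠ x := fun h => hxA (h ▸ hp.2.1)
      simpa only [switch, Function.update_self, Function.comp_apply,
        Equiv.swap_apply_of_ne_of_ne hia hix] using hp.2.2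
    · simpa only [switch, Function.update_of_ne hd] using hp.2.2
  have h₁ := Finset.card_le_card hsub
  have h₂ := Finset.pred_card_le_card_erase (s := arcsAvoiding c A B H) (a := (d, a))
  omega

/-- The elements of `𝒢_D` whose colour class `c` is `g₀` and which have at least `t` arcs
from `A` to `B` of colour other than `c`. -/
def upperTail {n : ℕ} {D : Finset (Fin n)} (c : {d : Fin n // d ∈ D}) (g₀ : Fin n → Fin n)
    (A B : Finset (Fin n)) (t : ℝ) : Finset (GD n D) :=
  Finset.univ.filter fun H => H.1 c = g₀ ∧ t ≤ (arcsAvoiding c A B H).card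

/-- The possible switchings of `H` which destroy an arc from `A` to `B`. -/
def downMoves {n : ℕ} {D : Finset (Fin n)} (c : {d : Fin n // d ∈ D}) (A B : Finset (Fin n))
    (H : GD n D) : Finset ((_ : {d : Fin n // d ∈ D} × Fin n) × Fin n) :=
  (arcsAvoiding c A B H).sigma fun p => (blockedTails A H p)ᶜ

/-- A superset of the switchings which lead to `H` by destroying an arc from `A` to `B`. -/
def upMoves {n : ℕ} {D : Finset (Fin n)} (A B : Finset (Fin n)) (H : GD n D) :
    Finset ((_ : {d : Fin n // d ∈ D} × Fin n) × Fin n) :=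
  Finset.univ.filter fun q => q.1.2 ∈ A ∧ H.1 q.1.1 q.2 ∈ B

lemma card_upMoves_le {n : ℕ} {D A B : Finset (Fin n)} (hA : A.card = D.card)
    (hB : B.card = D.card) (H : GD n D) : (upMoves A B H).card ≤ D.card ^ 3 := by
  have hD : Fintype.card {d : Fin n // d ∈ D} = D.card := by simp
  have hcard : ((Finset.univ : Finset {d : Fin n // d ∈ D}) ×ˢ A ×ˢ B).card = D.card ^ 3 := by
    rw [Finset.card_product, Finset.card_product, Finset.card_univ, hD, hA, hB]
    ring
  rw [← hcard]
  refine Finset.card_le_card_of_injOn (fun q => (q.1.1, q.1.2, H.1 q.1.1 q.2)) ?_ ?_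
  · intro q hq
    have hq' := (Finset.mem_filter.1 hq).2
    simpa using hq'
  · rintro ⟨⟨d, a⟩, x⟩ - ⟨⟨d', a'⟩, x'⟩ - h
    simp only [Prod.mk.injEq] at h
    obtain ⟨rfl, rfl, h⟩ := h
    rw [(H.2.1 d).1 h]

lemma card_downMoves_ge {n : ℕ} {D A B : Finset (Fin n)} {c : {d : Fin n // d ∈ D}}
    (hA : A.card = D.card) (H : GD n D) :
    (arcsAvoiding c A B H).card * ((n : ℝ) - 3 * D.card) ≤ (downMoves c A B H).card := by
  rw [downMoves, Finset.card_sigma, Nat.cast_sum, ← nsmul_eq_mul]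
  refine Finset.card_nsmul_le_sum _ _ _ fun p _ => ?_
  have h₁ := card_blockedTails_le hA H p
  have h₂ := Finset.card_add_card_compl (blockedTails A H p)
  rw [Fintype.card_fin] at h₂
  have h₁' : ((blockedTails A H p).card : ℝ) ≤ 3 * D.card := by exact_mod_cast h₁
  have h₂' : ((blockedTails A H p).card : ℝ) + ((blockedTails A H p)ᶜ).card = n := by
    exact_mod_cast h₂
  linarith

lemma card_sigma_downMoves_le {n : ℕ} {D A B : Finset (Fin n)} {c : {d : Fin n // d ∈ D}}
    (g₀ : Fin n → Fin n) (t : ℝ) :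
    ((upperTail c g₀ A B (t + 1)).sigma fun H => downMoves c A B H).card ≤
      ((upperTail c g₀ A B t).sigma fun H => upMoves A B H).card := by
  have hmem : ∀ z ∈ (upperTail c g₀ A B (t + 1)).sigma fun H => downMoves c A B H,
      (z.1.1 c = g₀ ∧ t + 1 ≤ (arcsAvoiding c A B z.1).card) ∧
      (z.2.1.1 ≠ c ∧ z.2.1.2 ∈ A ∧ z.1.1 z.2.1.1 z.2.1.2 ∈ B) ∧ z.2.2 ∉ A ∧
      (∀ d', z.1.1 d' z.2.1.2 ≠ z.1.1 z.2.1.1 z.2.2) ∧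
      ∀ d', z.1.1 d' z.2.2 ≠ z.1.1 z.2.1.1 z.2.1.2 := by
    intro z hz
    simpa [upperTail, downMoves, arcsAvoiding, blockedTails] using hz
  refine Finset.card_le_card_of_injOn (fun z =>
    if h : (∀ d', z.1.1 d' z.2.1.2 ≠ z.1.1 z.2.1.1 z.2.2) ∧
        ∀ d', z.1.1 d' z.2.2 ≠ z.1.1 z.2.1.1 z.2.1.2 then
      ⟨switch z.1 z.2.1.1 z.2.1.2 z.2.2 h.1 h.2, z.2⟩ else z) ?_ ?_
  · intro z hz
    obtain ⟨⟨hg, ht⟩, ⟨hdc, haA, haB⟩, hxA, h⟩ := hmem z hz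
    obtain ⟨H, ⟨d, a⟩, x⟩ := z
    simp only at hg ht hdc haA haB hxA h
    have hcard := card_arcsAvoiding_switch (c := c) (B := B) H hxA h.1 h.2
    have hcard' : ((arcsAvoiding c A B H).card : ℝ) ≤
        (arcsAvoiding c A B (switch H d a x h.1 h.2)).card + 1 := by exact_mod_cast hcard
    simp only [dif_pos h, Finset.mem_coe, Finset.mem_sigma, upperTail, upMoves,
      Finset.mem_filter, Finset.mem_univ, true_and]
    refine ⟨⟨?_, by linarith⟩, haA, ?_⟩
    · simpa only [switch, Function.update_of_ne hdc.symm] using hg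
    · simpa only [switch, Function.update_self, Function.comp_apply,
        Equiv.swap_apply_right] using haB
  · intro z hz z' hz' heq
    have h := (hmem z hz).2.2.2
    have h' := (hmem z' hz').2.2.2
    obtain ⟨H, q⟩ := z
    obtain ⟨H', q'⟩ := z'
    simp only [dif_pos h, dif_pos h', Sigma.mk.injEq, heq_eq_eq] at heq
    obtain ⟨hsw, rfl⟩ := heq
    obtain ⟨⟨d, a⟩, x⟩ := q
    have hfun := congrArg Subtype.val hsw
    simp only [switch] at hfun
    have hHH : H.1 = H'.1 := by
      funext d' i
      by_cases hd : d' = d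
      · subst hd
        have := congrFun (congrFun hfun d') (Equiv.swap a x i)
        simpa only [Function.update_self, Function.comp_apply, Equiv.swap_apply_self]
          using this
      · have := congrFun (congrFun hfun d') i
        simpa only [Function.update_of_ne hd] using this
    rw [Subtype.ext hHH]

lemma card_upperTail_succ_mul_le {n : ℕ} {D A B : Finset (Fin n)} (c : {d : Fin n // d ∈ D})
    (g₀ : Fin n → Fin n) (hA : A.card = D.card) (hB : B.card = D.card)
    (hn : (3 * D.card : ℝ) ≤ n) (t : ℝ) :
    (upperTail c g₀ A B (t + 1)).card * ((t + 1) * ((n : ℝ) - 3 * D.card)) ≤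
      (upperTail c g₀ A B t).card * (D.card : ℝ) ^ 3 := by
  have hcount : (((upperTail c g₀ A B (t + 1)).sigma fun H => downMoves c A B H).card : ℝ) ≤
      ((upperTail c g₀ A B t).sigma fun H => upMoves A B H).card := by
    exact_mod_cast card_sigma_downMoves_le g₀ t
  rw [Finset.card_sigma, Finset.card_sigma, Nat.cast_sum, Nat.cast_sum] at hcount
  rw [← nsmul_eq_mul, ← nsmul_eq_mul]
  refine le_trans (Finset.card_nsmul_le_sum _ _ _ fun H hH => ?_)
    (hcount.trans (Finset.sum_le_card_nsmul _ _ _ fun H _ => ?_))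
  · refine le_trans ?_ (card_downMoves_ge hA H)
    exact mul_le_mul_of_nonneg_right (Finset.mem_filter.1 hH).2.2 (by linarith)
  · exact_mod_cast card_upMoves_le hA hB H

/-- Above one and a half times the mean, the tail decays geometrically. -/
lemma card_upperTail_le {n : ℕ} {D A B : Finset (Fin n)} (c : {d : Fin n // d ∈ D})
    (g₀ : Fin n → Fin n) (hA : A.card = D.card) (hB : B.card = D.card)
    (hn : (n : ℝ) = 10 ^ 6 * D.card) (j : ℕ) :
    ((upperTail c g₀ A B (3 / 2 * ((D.card : ℝ) ^ 2 / 10 ^ 6) + j)).card : ℝ) ≤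
      (3 / 4) ^ j * Nat.card {H : GD n D // H.1 c = g₀} := by
  induction j with
  | zero =>
    rw [pow_zero, one_mul, Nat.card_eq_fintype_card, Fintype.card_subtype]
    norm_cast
    refine Finset.card_le_card fun H hH => ?_
    simpa using (Finset.mem_filter.1 hH).2.1
  | succ j ih =>
    have hk : (0 : ℝ) < D.card := by
      exact_mod_cast Finset.card_pos.2 ⟨_, c.2⟩
    set q : ℝ := (D.card : ℝ) ^ 2 / 10 ^ 6 with hq
    have hqpos : 0 < q := by positivity
    have hstep := card_upperTail_succ_mul_le c g₀ hA hB (by linarith) (3 / 2 * q + j)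
    have hcube : (D.card : ℝ) ^ 3 = 10 ^ 6 * D.card * q := by
      rw [hq]; ring
    rw [hcube, hn] at hstep
    push_cast
    rw [← add_assoc, pow_succ]
    set T₁ : ℝ := ((upperTail c g₀ A B (3 / 2 * q + j + 1)).card : ℝ)
    set T₀ : ℝ := ((upperTail c g₀ A B (3 / 2 * q + j)).card : ℝ)
    have hT₁ : 0 ≤ T₁ := Nat.cast_nonneg _
    have hlow : 10 ^ 6 * D.card * q * (4 / 3) ≤
        (3 / 2 * q + j + 1) * (10 ^ 6 * D.card - 3 * D.card) := by
      have hj : (0 : ℝ) ≤ j := Nat.cast_nonneg _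
      nlinarith [mul_pos hk hqpos, mul_nonneg hj hk.le]
    have hkey : T₁ * (4 / 3) ≤ T₀ := by
      refine le_of_mul_le_mul_right (a := 10 ^ 6 * D.card * q) ?_ (by positivity)
      calc T₁ * (4 / 3) * (10 ^ 6 * D.card * q) = T₁ * (10 ^ 6 * D.card * q * (4 / 3)) := by ring
        _ ≤ _ := mul_le_mul_of_nonneg_left hlow hT₁
        _ ≤ _ := hstep
    nlinarith

lemma eArcs_le_card_arcsAvoiding {n : ℕ} {D A B : Finset (Fin n)} (c : {d : Fin n // d ∈ D})
    (H : GD n D) : eArcs H A B ≤ (arcsAvoiding c A B H).card + A.card := by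
  rw [eArcs, Nat.card_eq_fintype_card, Fintype.card_subtype,
    ← Finset.card_image_of_injective A (Prod.mk_right_injective c)]
  refine le_trans (Finset.card_le_card fun p hp => ?_) (Finset.card_union_le _ _)
  obtain ⟨d, i⟩ := p
  have hp' := (Finset.mem_filter.1 hp).2
  by_cases hd : d = c
  · subst hd
    exact Finset.mem_union_right _ (Finset.mem_image_of_mem _ hp'.1)
  · exact Finset.mem_union_left _ (Finset.mem_filter.2 ⟨Finset.mem_univ _, hd, hp'⟩)

lemma four_pow_mul_three_quarters_pow_le {n : ℕ} (hn : 10 ^ 21 ≤ n) :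
    (4 : ℝ) ^ n * (3 / 4) ^ ⌊(n : ℝ) ^ 2 / 10 ^ 18 / 4⌋₊ ≤
      Real.exp (-(1 / 10 ^ 20 * (n : ℝ) ^ 2)) := by
  have hn' : (10 : ℝ) ^ 21 ≤ n := by exact_mod_cast hn
  have h₄ : (4 : ℝ) ≤ Real.exp 2 := by
    have := Real.add_one_le_exp (1 : ℝ)
    rw [show (2 : ℝ) = 1 + 1 by norm_num, Real.exp_add]
    nlinarith
  have h₃ : (3 / 4 : ℝ) ≤ Real.exp (-(1 / 4)) := by
    have := Real.add_one_le_exp (-(1 / 4) : ℝ)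
    linarith
  have hj := Nat.sub_one_lt_floor ((n : ℝ) ^ 2 / 10 ^ 18 / 4)
  calc (4 : ℝ) ^ n * (3 / 4) ^ ⌊(n : ℝ) ^ 2 / 10 ^ 18 / 4⌋₊
      ≤ Real.exp 2 ^ n * Real.exp (-(1 / 4)) ^ ⌊(n : ℝ) ^ 2 / 10 ^ 18 / 4⌋₊ := by gcongr
    _ = Real.exp (n * 2 + ⌊(n : ℝ) ^ 2 / 10 ^ 18 / 4⌋₊ * -(1 / 4)) := by
        rw [Real.exp_add, Real.exp_nat_mul, Real.exp_nat_mul]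
    _ ≤ _ := by
        apply Real.exp_le_exp.2
        nlinarith

/-- For `|D| = n/10⁶`, `c ∈ D` and a uniformly random `H ∈ 𝒢_D`,
conditionally on any possible outcome of the colour class of `c`, `H` is
`1`-upper-quasirandom with probability at least `1 - exp(-a n²)`. -/
theorem statement_6 :
    ∃ a : ℝ, 0 < a ∧ ∃ n₀ : ℕ, ∀ n : ℕ, n₀ ≤ n → 10 ^ 6 ∣ n →
      ∀ D : Finset (Fin n), D.card = n / 10 ^ 6 →
      ∀ c : Fin n, ∀ hc : c ∈ D, ∀ g₀ : Fin n → Fin n,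
        (∃ H : GD n D, H.1 ⟨c, hc⟩ = g₀) →
        (1 - Real.exp (-(a * (n : ℝ) ^ 2))) *
            (Nat.card {H : GD n D // H.1 ⟨c, hc⟩ = g₀} : ℝ) ≤
          (Nat.card {H : GD n D // H.1 ⟨c, hc⟩ = g₀ ∧
            ∀ A₁ A₂ : Finset (Fin n), A₁.card = D.card → A₂.card = D.card →
              (eArcs H A₁ A₂ : ℝ) ≤ 2 * (D.card : ℝ) ^ 3 / n} : ℝ) := by
  refine ⟨1 / 10 ^ 20, by norm_num, 10 ^ 21, fun n hn hdvd D hD c hc g₀ _ => ?_⟩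
  have hn' : (10 : ℝ) ^ 21 ≤ n := by exact_mod_cast hn
  have hnk : (n : ℝ) = 10 ^ 6 * D.card := by
    have : n = 10 ^ 6 * D.card := by rw [hD, Nat.mul_div_cancel' hdvd]
    exact_mod_cast this
  have hk : (10 : ℝ) ^ 15 ≤ D.card := by linarith
  set c' : {d : Fin n // d ∈ D} := ⟨c, hc⟩
  set q : ℝ := (D.card : ℝ) ^ 2 / 10 ^ 6 with hq
  have hqn : q = (n : ℝ) ^ 2 / 10 ^ 18 := by
    rw [hq, hnk]; ring
  have hmean : 2 * (D.card : ℝ) ^ 3 / n = 2 * q := by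
    rw [hq, hnk]
    field_simp
  set j : ℕ := ⌊q / 4⌋₊ with hj
  have hjle : (j : ℝ) ≤ q / 4 := Nat.floor_le (by positivity)
  set N : ℝ := (Nat.card {H : GD n D // H.1 c' = g₀} : ℝ) with hN
  have hN0 : 0 ≤ N := Nat.cast_nonneg _
  set good : Finset (GD n D) := Finset.univ.filter fun H => H.1 c' = g₀ ∧
    ∀ A₁ A₂ : Finset (Fin n), A₁.card = D.card → A₂.card = D.card →
      (eArcs H A₁ A₂ : ℝ) ≤ 2 * (D.card : ℝ) ^ 3 / n with hgood
  set pairs : Finset (Finset (Fin n) × Finset (Fin n)) :=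
    Finset.univ.filter fun p => p.1.card = D.card ∧ p.2.card = D.card
  set bad : Finset (GD n D) :=
    pairs.biUnion fun p => upperTail c' g₀ p.1 p.2 (3 / 2 * q + j)
  have hcover : (Finset.univ.filter fun H : GD n D => H.1 c' = g₀) ⊆ good ∪ bad := by
    intro H hH
    have hHc := (Finset.mem_filter.1 hH).2
    by_cases hgoodH : H ∈ good
    · exact Finset.mem_union_left _ hgoodH
    refine Finset.mem_union_right _ ?_
    simp only [hgood, Finset.mem_filter, Finset.mem_univ, true_and, hHc] at hgoodH
    push Not at hgoodH
    obtain ⟨A, B, hA, hB, hAB⟩ := hgoodH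
    refine Finset.mem_biUnion.2
      ⟨(A, B), Finset.mem_filter.2 ⟨Finset.mem_univ _, hA, hB⟩,
        Finset.mem_filter.2 ⟨Finset.mem_univ _, hHc, ?_⟩⟩
    have hle : (eArcs H A B : ℝ) ≤ (arcsAvoiding c' A B H).card + D.card := by
      have := eArcs_le_card_arcsAvoiding (A := A) (B := B) c' H
      rw [hA] at this
      exact_mod_cast this
    have hkq : (D.card : ℝ) ≤ q / 4 := by
      rw [hq]
      nlinarith
    rw [hmean] at hAB
    linarith
  have hbad : (bad.card : ℝ) ≤ 4 ^ n * (3 / 4) ^ j * N := by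
    calc (bad.card : ℝ) ≤ ∑ p ∈ pairs, ((upperTail c' g₀ p.1 p.2 (3 / 2 * q + j)).card : ℝ) := by
          exact_mod_cast Finset.card_biUnion_le
      _ ≤ pairs.card • ((3 / 4) ^ j * N) := by
          refine Finset.sum_le_card_nsmul _ _ _ fun p hp => ?_
          have hp' := (Finset.mem_filter.1 hp).2
          exact card_upperTail_le c' g₀ hp'.1 hp'.2 hnk j
      _ ≤ _ := by
          rw [nsmul_eq_mul, mul_assoc]
          refine mul_le_mul_of_nonneg_right ?_ (by positivity)
          have hcard : pairs.card ≤ 4 ^ n := by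
            refine (Finset.card_le_univ _).trans_eq ?_
            norm_num [← mul_pow]
          exact_mod_cast hcard
  have hexp : (4 : ℝ) ^ n * (3 / 4) ^ j ≤ Real.exp (-(1 / 10 ^ 20 * (n : ℝ) ^ 2)) := by
    rw [hj, hqn]
    exact four_pow_mul_three_quarters_pow_le hn
  have hNle : N ≤ good.card + bad.card := by
    rw [hN, Nat.card_eq_fintype_card, Fintype.card_subtype]
    exact_mod_cast (Finset.card_le_card hcover).trans (Finset.card_union_le _ _)
  have hfinal := hbad.trans (mul_le_mul_of_nonneg_right hexp hN0)
  rw [Nat.card_eq_fintype_card, Fintype.card_subtype]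
  change _ ≤ (good.card : ℝ)
  linarith

end RandomLatin
end
end
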